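/- arXiv:2309.05008 — 6 statements merged into one kernel-verified Lean document; each statement's English description precedes it below -/
import Mathlib

section
/- Let V be a finite-dimensional real vector space and Q a symmetric bilinear form on V that has at most one positive eigenvalue. Then for any v, w ∈ V with Q(v,v) ≥ 0 one has Q(v,w)² ≥ Q(v,v)·Q(w,w). -/
/-- Let `V` be a finite-dimensional real vector space and `Q` a symmetric
bilinear form on `V` that has at most one positive eigenvalue (i.e. every subspace on which
`Q` is positive definite has dimension at most 1). Then for any `v, w ∈ V` with `Q v v ≥ 0`
one has `Q v w ^ 2 ≥ Q v v * Q w w`. -/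
theorem lorentzian_cauchy_schwarz
    {V : Type*} [AddCommGroup V] [Module ℝ V] [FiniteDimensional ℝ V]
    (Q : V →ₗ[ℝ] V →ₗ[ℝ] ℝ)
    (hQsymm : ∀ x y : V, Q x y = Q y x)
    (hQone : ∀ W : Submodule ℝ V, (∀ x ∈ W, x ≠ 0 → 0 < Q x x) → Module.finrank ℝ W ≤ 1)
    (v w : V) (hv : 0 ≤ Q v v) :
    Q v v * Q w w ≤ Q v w ^ 2 := by
  by_contra! h
  have hv' : 0 < Q v v := hv.lt_of_ne fun h0 => by
    rw [← h0, zero_mul] at h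
    exact (sq_nonneg _).not_gt h
  have key : ∀ a b : ℝ, Q v v * Q (a • v + b • w) (a • v + b • w) =
      (a * Q v v + b * Q v w) ^ 2 + b ^ 2 * (Q v v * Q w w - Q v w ^ 2) := fun a b => by
    simp only [map_add, map_smul, LinearMap.add_apply, LinearMap.smul_apply, smul_eq_mul,
      hQsymm w v]
    ring
  have hzero : ∀ a b : ℝ, Q (a • v + b • w) (a • v + b • w) ≤ 0 → a = 0 ∧ b = 0 := by
    intro a b hab
    have hk := key a b
    have hle := mul_nonpos_of_nonneg_of_nonpos hv hab
    have hb : b = 0 := by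
      by_contra hb
      have := mul_pos (pow_pos (abs_pos.mpr hb) 2) (sub_pos.mpr h)
      rw [sq_abs] at this
      linarith [sq_nonneg (a * Q v v + b * Q v w)]
    subst hb
    refine ⟨?_, rfl⟩
    have ha : a * Q v v = 0 := by
      apply pow_eq_zero_iff two_ne_zero |>.mp
      apply le_antisymm _ (sq_nonneg _)
      linarith
    exact (mul_eq_zero.mp ha).resolve_right hv'.ne'
  have hli : LinearIndependent ℝ ![v, w] :=
    LinearIndependent.pair_iff.mpr fun a b hab => hzero a b (by simp [hab])
  have hrank := finrank_span_eq_card hli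
  have hle := hQone (Submodule.span ℝ (Set.range ![v, w])) fun x hx hx0 => by
    rw [Matrix.range_cons_cons_empty, Submodule.mem_span_pair] at hx
    obtain ⟨a, b, rfl⟩ := hx
    by_contra! hneg
    obtain ⟨rfl, rfl⟩ := hzero a b hneg
    simp at hx0
  simp [hrank] at hle
end

section
/- Let V be a finite-dimensional real vector space and Q a symmetric bilinear form on V that has at most one positive eigenvalue. Then for any v, w ∈ V with Q(v,v) > 0, the equality Q(v,w)² = Q(v,v)·Q(w,w) holds if and only if w − (Q(v,w)/Q(v,v))·v ∈ ker Q. -/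
/-- If positive definite subspaces are at most one-dimensional, then `Q` is nonpositive on the
orthogonal complement of a positive vector. -/
lemma apply_self_nonpos_of_orthogonal_pos
    {V : Type*} [AddCommGroup V] [Module ℝ V]
    (Q : V →ₗ[ℝ] V →ₗ[ℝ] ℝ)
    (hQsymm : ∀ x y : V, Q x y = Q y x)
    (hQone : ∀ W : Submodule ℝ V, (∀ x ∈ W, x ≠ 0 → 0 < Q x x) → Module.finrank ℝ W ≤ 1)
    {v u : V} (hv : 0 < Q v v) (hvu : Q v u = 0) : Q u u ≤ 0 := by
  by_contra! hu
  have expand (a b : ℝ) : Q (a • v + b • u) (a • v + b • u) = a ^ 2 * Q v v + b ^ 2 * Q u u := by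
    simp [hvu, hQsymm u v]
    ring
  have hli : LinearIndependent ℝ ![v, u] := by
    rw [LinearIndependent.pair_iff]
    intro a b hab
    have h := expand a b
    rw [hab] at h
    simp only [map_zero] at h
    have ha : 0 ≤ a ^ 2 * Q v v := by positivity
    have hb : 0 ≤ b ^ 2 * Q u u := by positivity
    have ha' : a ^ 2 * Q v v = 0 := by linarith
    have hb' : b ^ 2 * Q u u = 0 := by linarith
    exact ⟨by simpa [hv.ne'] using ha', by simpa [hu.ne'] using hb'⟩
  have hrank := finrank_span_eq_card hli
  have hle := hQone (Submodule.span ℝ (Set.range ![v, u])) (by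
    intro x hx hx0
    rw [Matrix.range_cons_cons_empty, Submodule.mem_span_pair] at hx
    obtain ⟨a, b, rfl⟩ := hx
    rw [expand]
    by_cases ha : a = 0
    · have hb : b ≠ 0 := by
        rintro rfl
        simp [ha] at hx0
      positivity
    · positivity)
  rw [hrank] at hle
  simp at hle


/-- Let `V` be a finite-dimensional real vector space and `Q` a symmetric
bilinear form on `V` that has at most one positive eigenvalue. Then for any `v, w ∈ V` with
`Q v v > 0`, the equality `Q v w ^ 2 = Q v v * Q w w` holds if and only if
`w - (Q v w / Q v v) • v` lies in the kernel of `Q`. -/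
theorem lorentzian_cauchy_schwarz_equality_iff
    {V : Type*} [AddCommGroup V] [Module ℝ V] [FiniteDimensional ℝ V]
    (Q : V →ₗ[ℝ] V →ₗ[ℝ] ℝ)
    (hQsymm : ∀ x y : V, Q x y = Q y x)
    (hQone : ∀ W : Submodule ℝ V, (∀ x ∈ W, x ≠ 0 → 0 < Q x x) → Module.finrank ℝ W ≤ 1)
    (v w : V) (hv : 0 < Q v v) :
    Q v w ^ 2 = Q v v * Q w w ↔ ∀ y : V, Q (w - (Q v w / Q v v) • v) y = 0 := by
  have orth (y : V) : Q v (y - (Q v y / Q v v) • v) = 0 := by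
    simp [hv.ne']
  constructor
  · intro h y
    set u := w - (Q v w / Q v v) • v with hu
    have hvu : Q v u = 0 := orth w
    have huu : Q u u = 0 := by
      have huw : Q u u = Q u w := by
        conv_lhs => rw [hu, map_sub, ← hu]
        simp [hQsymm u v, hvu]
      rw [huw, hu]
      simp only [map_sub, map_smul, LinearMap.sub_apply, LinearMap.smul_apply, smul_eq_mul]
      field_simp
      linarith
    set z := y - (Q v y / Q v v) • v with hz
    have hvz : Q v z = 0 := orth y
    have huz : Q u z = Q u y := by
      simp [hz, hQsymm u v, hvu]
    rw [← huz]
    by_contra hne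
    obtain ⟨t, ht⟩ : ∃ t : ℝ, t * Q u z = (1 - Q z z) / 2 :=
      ⟨(1 - Q z z) / 2 / Q u z, div_mul_cancel₀ _ hne⟩
    have hle := apply_self_nonpos_of_orthogonal_pos Q hQsymm hQone hv
      (u := z + t • u) (by simp [hvz, hvu])
    simp only [map_add, map_smul, LinearMap.add_apply, LinearMap.smul_apply, smul_eq_mul,
      hQsymm z u, huu] at hle
    linarith
  · intro h
    have hw := h w
    simp only [map_sub, map_smul, LinearMap.sub_apply, LinearMap.smul_apply, smul_eq_mul] at hw
    field_simp at hw
    linarith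
end

section
/- Let F be a C-Lorentzian symmetric n-multilinear form (n ≥ 2) on a finite-dimensional real vector space V, where C ⊆ V is a nonempty open convex cone, and let C̄ denote the closure of C. Then for all v₁, ..., vₙ ∈ C̄ one has the Hodge index (Alexandrov–Fenchel) inequality F(v₁,v₂,v₃,...,vₙ)² ≥ F(v₁,v₁,v₃,...,vₙ)·F(v₂,v₂,v₃,...,vₙ). -/
/-- `biEval F v x y` is `F` evaluated with first argument `x`, second argument `y`, and the
remaining arguments `v 2, ..., v (n-1)`. -/
noncomputable def biEval {V : Type*} [AddCommGroup V] [Module ℝ V] {n : ℕ}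
    (F : MultilinearMap ℝ (fun _ : Fin n => V) ℝ) (v : Fin n → V) (x y : V) : ℝ :=
  F (fun i => if (i : ℕ) = 0 then x else if (i : ℕ) = 1 then y else v i)

section BiEval

variable {V : Type*} [AddCommGroup V] [Module ℝ V] {n : ℕ}
  (F : MultilinearMap ℝ (fun _ : Fin n => V) ℝ) (v : Fin n → V)

lemma biEval_eq_update (hn : 2 ≤ n) (x y : V) :
    biEval F v x y =
      F (Function.update (Function.update v ⟨0, by omega⟩ x) ⟨1, by omega⟩ y) := by
  unfold biEval
  congr 1
  funext i
  simp only [Function.update_apply, Fin.ext_iff]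
  split_ifs <;> first | rfl | omega

lemma biEval_comm (hn : 2 ≤ n)
    (hFsymm : ∀ (σ : Equiv.Perm (Fin n)) (w : Fin n → V), F (w ∘ σ) = F w) (x y : V) :
    biEval F v x y = biEval F v y x := by
  unfold biEval
  rw [← hFsymm (Equiv.swap ⟨0, by omega⟩ ⟨1, by omega⟩)]
  congr 1
  funext i
  simp only [Function.comp_apply, Equiv.swap_apply_def, Fin.ext_iff]
  by_cases h₀ : (i : ℕ) = 0
  · simp [h₀]
  · by_cases h₁ : (i : ℕ) = 1 <;> simp [h₀, h₁]

lemma biEval_comb_right (hn : 2 ≤ n) (a b : ℝ) (z x y : V) :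
    biEval F v z (a • x + b • y) = a * biEval F v z x + b * biEval F v z y := by
  simp only [biEval_eq_update F v hn, F.map_update_add, F.map_update_smul, smul_eq_mul]

lemma biEval_comb_self (hn : 2 ≤ n)
    (hFsymm : ∀ (σ : Equiv.Perm (Fin n)) (w : Fin n → V), F (w ∘ σ) = F w)
    (a b : ℝ) (x y : V) :
    biEval F v (a • x + b • y) (a • x + b • y) =
      a ^ 2 * biEval F v x x + 2 * a * b * biEval F v x y + b ^ 2 * biEval F v y y := by
  rw [biEval_comb_right F v hn, biEval_comm F v hn hFsymm _ x,
    biEval_comm F v hn hFsymm _ y, biEval_comb_right F v hn, biEval_comb_right F v hn,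
    biEval_comm F v hn hFsymm y x]
  ring

end BiEval

lemma binary_quadratic_pos {A B D : ℝ} (hA : 0 < A) (h : B ^ 2 < A * D) {a b : ℝ}
    (hab : ¬(a = 0 ∧ b = 0)) : 0 < a ^ 2 * A + 2 * a * b * B + b ^ 2 * D := by
  refine pos_of_mul_pos_right (a := A) ?_ hA.le
  have key : A * (a ^ 2 * A + 2 * a * b * B + b ^ 2 * D) =
      (a * A + b * B) ^ 2 + b ^ 2 * (A * D - B ^ 2) := by ring
  rw [key]
  by_cases hb : b = 0
  · have ha : a ≠ 0 := fun ha => hab ⟨ha, hb⟩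
    subst hb
    simp only [zero_mul, add_zero]
    positivity
  · have := mul_pos (pow_pos (abs_pos.2 hb) 2) (sub_pos.2 h)
    rw [sq_abs] at this
    positivity

/-- The reversed Cauchy–Schwarz inequality for a form positive at `x` that is positive definite
on no plane. -/
lemma biEval_mul_le_sq {V : Type*} [AddCommGroup V] [Module ℝ V] {n : ℕ} (hn : 2 ≤ n)
    (F : MultilinearMap ℝ (fun _ : Fin n => V) ℝ) (v : Fin n → V)
    (hFsymm : ∀ (σ : Equiv.Perm (Fin n)) (w : Fin n → V), F (w ∘ σ) = F w)
    (hW : ∀ W : Submodule ℝ V, (∀ ξ ∈ W, ξ ≠ 0 → 0 < biEval F v ξ ξ) →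
      Module.finrank ℝ W ≤ 1)
    {x : V} (hx : 0 < biEval F v x x) (y : V) :
    biEval F v x x * biEval F v y y ≤ biEval F v x y ^ 2 := by
  by_contra! hlt
  have hpos : ∀ a b : ℝ, ¬(a = 0 ∧ b = 0) →
      0 < biEval F v (a • x + b • y) (a • x + b • y) := fun a b hab => by
    rw [biEval_comb_self F v hn hFsymm]
    exact binary_quadratic_pos hx hlt hab
  have hzero : biEval F v 0 0 = 0 := by
    simpa using biEval_comb_right F v hn 0 0 0 0 0
  have hli : LinearIndependent ℝ ![x, y] := by
    rw [LinearIndependent.pair_iff]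
    intro a b hab
    by_contra hne
    have := hpos a b hne
    rw [hab, hzero] at this
    exact this.false
  have hrank := finrank_span_eq_card hli
  have hle := hW (Submodule.span ℝ (Set.range ![x, y])) fun ξ hξ hne => by
    rw [Matrix.range_cons_cons_empty, Submodule.mem_span_pair] at hξ
    obtain ⟨a, b, rfl⟩ := hξ
    refine hpos a b ?_
    rintro ⟨rfl, rfl⟩
    simp at hne
  rw [hrank] at hle
  simp at hle

lemma MultilinearMap.continuous_of_finiteDimensional_domain {ι V : Type*} [Fintype ι]
    [NormedAddCommGroup V] [NormedSpace ℝ V] [FiniteDimensional ℝ V]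
    (F : MultilinearMap ℝ (fun _ : ι => V) ℝ) : Continuous F := by
  classical
  let b := Module.finBasis ℝ V
  have key : ∀ w : ι → V, F w = ∑ r : ι → Fin (Module.finrank ℝ V),
      (∏ i, b.coord (r i) (w i)) * F fun i => b (r i) := fun w => by
    conv_lhs => rw [show w = fun i => ∑ j, b.coord j (w i) • b j from
      funext fun i => (b.sum_repr (w i)).symm]
    rw [F.map_sum]
    exact Finset.sum_congr rfl fun r _ => F.map_smul_univ _ _
  rw [funext key]
  refine continuous_finsetSum _ fun r _ =>
    (continuous_finsetProd _ fun i _ => ?_).mul continuous_const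
  exact (b.coord (r i)).continuous_of_finiteDimensional.comp (continuous_apply i)

lemma continuous_biEval {V : Type*} [NormedAddCommGroup V] [NormedSpace ℝ V]
    [FiniteDimensional ℝ V] {n : ℕ} (F : MultilinearMap ℝ (fun _ : Fin n => V) ℝ)
    {X : Type*} [TopologicalSpace X] {v : X → Fin n → V} {f g : X → V}
    (hv : Continuous v) (hf : Continuous f) (hg : Continuous g) :
    Continuous fun p => biEval F (v p) (f p) (g p) := by
  unfold biEval
  refine F.continuous_of_finiteDimensional_domain.comp (continuous_pi fun i => ?_)
  split_ifs
  · exact hf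
  · exact hg
  · exact (continuous_apply i).comp hv

/-- Let `F` be a `C`-Lorentzian symmetric `n`-multilinear form (`n ≥ 2`) on a
finite-dimensional real vector space `V`, where `C ⊆ V` is a nonempty open convex cone. Then
for all `v₁, v₂` and `v₃, ..., vₙ` in the closure of `C` one has the Hodge index
(Alexandrov–Fenchel) inequality
`F(v₁,v₂,v₃,...,vₙ)² ≥ F(v₁,v₁,v₃,...,vₙ) * F(v₂,v₂,v₃,...,vₙ)`. -/
theorem lorentzian_hodge_index_inequality
    {V : Type*} [NormedAddCommGroup V] [NormedSpace ℝ V] [FiniteDimensional ℝ V]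
    {n : ℕ} (hn : 2 ≤ n)
    (C : Set V) (hCne : C.Nonempty) (hCopen : IsOpen C) (hCconv : Convex ℝ C)
    (hCcone : ∀ x ∈ C, ∀ t : ℝ, 0 < t → t • x ∈ C)
    (F : MultilinearMap ℝ (fun _ : Fin n => V) ℝ)
    (hFsymm : ∀ (σ : Equiv.Perm (Fin n)) (v : Fin n → V), F (v ∘ σ) = F v)
    (hFpos : ∀ v : Fin n → V, (∀ i, v i ∈ C) → 0 < F v)
    (hFlor : ∀ v : Fin n → V, (∀ i : Fin n, 2 ≤ (i : ℕ) → v i ∈ C) →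
      (∃ ξ : V, 0 < biEval F v ξ ξ) ∧
      ∀ W : Submodule ℝ V, (∀ ξ ∈ W, ξ ≠ 0 → 0 < biEval F v ξ ξ) →
        Module.finrank ℝ W ≤ 1)
    (v₁ v₂ : V) (h₁ : v₁ ∈ closure C) (h₂ : v₂ ∈ closure C)
    (v : Fin n → V) (hv : ∀ i : Fin n, 2 ≤ (i : ℕ) → v i ∈ closure C) :
    biEval F v v₁ v₁ * biEval F v v₂ v₂ ≤ biEval F v v₁ v₂ ^ 2 := by
  have hclosed : IsClosed {p : V × V × (Fin n → V) |
      biEval F p.2.2 p.1 p.1 * biEval F p.2.2 p.2.1 p.2.1 ≤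
        biEval F p.2.2 p.1 p.2.1 ^ 2} := by
    have hw : Continuous fun p : V × V × (Fin n → V) => p.2.2 := by fun_prop
    have hx : Continuous fun p : V × V × (Fin n → V) => p.1 := by fun_prop
    have hy : Continuous fun p : V × V × (Fin n → V) => p.2.1 := by fun_prop
    exact isClosed_le
      ((continuous_biEval F hw hx hx).mul (continuous_biEval F hw hy hy))
      ((continuous_biEval F hw hx hy).pow 2)
  have hsub : C ×ˢ C ×ˢ Set.pi {i : Fin n | 2 ≤ (i : ℕ)} (fun _ => C) ⊆
      {p : V × V × (Fin n → V) |
        biEval F p.2.2 p.1 p.1 * biEval F p.2.2 p.2.1 p.2.1 ≤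
          biEval F p.2.2 p.1 p.2.1 ^ 2} := by
    rintro ⟨x, y, w⟩ ⟨hx, -, hw⟩
    refine biEval_mul_le_sq hn F w hFsymm (hFlor w hw).2 (hFpos _ fun i => ?_) y
    split_ifs with h h'
    · exact hx
    · exact hx
    · exact hw i (show 2 ≤ (i : ℕ) by omega)
  refine closure_minimal hsub hclosed (a := (v₁, v₂, v)) ?_
  rw [closure_prod_eq, closure_prod_eq, closure_pi_set]
  exact ⟨h₁, h₂, hv⟩
end

section
/- Let F be a C-Lorentzian symmetric n-multilinear form on a finite-dimensional real vector space V, where C ⊆ V is a nonempty open convex cone with closure C̄. Then for every v ∈ C̄ the number nd_w(v) = max{k ∈ {0,1,...,n} : F(v[k], w[n−k]) > 0} is independent of the choice of w ∈ C; that is, nd_{w₁}(v) = nd_{w₂}(v) for all w₁, w₂ ∈ C. -/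
/-- `numDim F w v = max {k ∈ {0,...,n} : F(v[k], w[n-k]) > 0}`, the numerical dimension of `v`
computed with respect to `w`. -/
noncomputable def numDim {V : Type*} [AddCommGroup V] [Module ℝ V] {n : ℕ}
    (F : MultilinearMap ℝ (fun _ : Fin n => V) ℝ) (w v : V) : ℕ :=
  sSup {k : ℕ | k ≤ n ∧ 0 < F (fun i => if (i : ℕ) < k then v else w)}

/-- A multilinear form on a finite-dimensional real normed space is continuous. -/
theorem MultilinearMap.continuous_of_finiteDimensional_real
    {V : Type*} [NormedAddCommGroup V] [NormedSpace ℝ V] [FiniteDimensional ℝ V] {n : ℕ}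
    (F : MultilinearMap ℝ (fun _ : Fin n => V) ℝ) : Continuous F := by
  let b := Module.finBasis ℝ V
  have hexpand : ∀ x : Fin n → V,
      F x = ∑ r : Fin n → Fin (Module.finrank ℝ V),
        (∏ i, b.coord (r i) (x i)) • F (fun i => b (r i)) := by
    intro x
    conv_lhs => rw [show x = fun i => ∑ j, b.coord j (x i) • b j from
      funext fun i => (b.sum_repr (x i)).symm]
    rw [F.map_sum]
    exact Finset.sum_congr rfl fun r _ => F.map_smul_univ _ _
  rw [funext hexpand]
  have hcoord : ∀ j, Continuous (b.coord j) := fun j =>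
    LinearMap.continuous_of_finiteDimensional _
  exact continuous_finsetSum _ fun r _ => (continuous_finsetProd _ fun i _ =>
    (hcoord (r i)).comp (continuous_apply i)).smul continuous_const

/-- A multilinear form that is positive on a set is nonnegative on its closure. -/
theorem MultilinearMap.nonneg_of_mem_closure
    {V : Type*} [NormedAddCommGroup V] [NormedSpace ℝ V] [FiniteDimensional ℝ V] {n : ℕ}
    {C : Set V} (F : MultilinearMap ℝ (fun _ : Fin n => V) ℝ)
    (hFpos : ∀ v : Fin n → V, (∀ i, v i ∈ C) → 0 < F v)
    (x : Fin n → V) (hx : ∀ i, x i ∈ closure C) : 0 ≤ F x := by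
  have hcont : Continuous F := F.continuous_of_finiteDimensional_real
  have hmem : x ∈ closure (Set.univ.pi fun _ : Fin n => C) := by
    rw [closure_pi_set]
    exact fun i _ => hx i
  exact closure_minimal (t := {y | 0 ≤ F y})
    (fun y (hy : y ∈ Set.univ.pi fun _ : Fin n => C) => (hFpos y fun i => hy i trivial).le)
    (isClosed_le continuous_const hcont) hmem

/-- A multilinear form that is nonnegative on a set is monotone for the order this set induces. -/
theorem MultilinearMap.le_map_add_of_nonneg
    {V : Type*} [AddCommGroup V] [Module ℝ V] {n : ℕ}
    {K : Set V} (F : MultilinearMap ℝ (fun _ : Fin n => V) ℝ)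
    (hF : ∀ x : Fin n → V, (∀ i, x i ∈ K) → 0 ≤ F x)
    (a b : Fin n → V) (ha : ∀ i, a i ∈ K) (hb : ∀ i, b i ∈ K) : F a ≤ F (a + b) := by
  classical
  rw [F.map_add_univ]
  have key := Finset.single_le_sum (f := fun s : Finset (Fin n) => F (s.piecewise a b))
    (fun s _ => hF _ fun i => by by_cases h : i ∈ s <;> simp [h, ha, hb])
    (Finset.mem_univ Finset.univ)
  simpa using key

/-- Positivity of `F(v[k], w[n-k])` for `v` in the closure of the open cone `C` passes from one
`w ∈ C` to any other. -/
theorem MultilinearMap.pos_of_pos_of_mem_cone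
    {V : Type*} [NormedAddCommGroup V] [NormedSpace ℝ V] [FiniteDimensional ℝ V]
    {n : ℕ} {C : Set V} (hCopen : IsOpen C)
    (hCcone : ∀ x ∈ C, ∀ t : ℝ, 0 < t → t • x ∈ C)
    (F : MultilinearMap ℝ (fun _ : Fin n => V) ℝ)
    (hFpos : ∀ v : Fin n → V, (∀ i, v i ∈ C) → 0 < F v)
    {v w w' : V} (hv : v ∈ closure C) (hw : w ∈ C) (hw' : w' ∈ C) (k : ℕ)
    (h : 0 < F (fun i => if (i : ℕ) < k then v else w)) :
    0 < F (fun i => if (i : ℕ) < k then v else w') := by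
  have hscale : ∀ x ∈ closure C, ∀ t : ℝ, 0 < t → t • x ∈ closure C := fun x hx t ht =>
    map_mem_closure (continuous_const_smul t) hx fun y hy => hCcone y hy t ht
  obtain ⟨ε, hεC, hε0, hε1⟩ : ∃ ε : ℝ, w' - ε • w ∈ C ∧ 0 < ε ∧ ε < 1 := by
    have hcont : Continuous fun ε : ℝ => w' - ε • w := by fun_prop
    have hnear : ∀ᶠ ε : ℝ in nhds 0, w' - ε • w ∈ C :=
      hcont.continuousAt.eventually_mem (hCopen.mem_nhds (by simpa using hw'))
    exact ((hnear.filter_mono nhdsWithin_le_nhds).and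
      (Ioo_mem_nhdsGT (zero_lt_one' ℝ))).exists
  have hle := F.le_map_add_of_nonneg (F.nonneg_of_mem_closure hFpos)
    (fun i => ε • if (i : ℕ) < k then v else w)
    (fun i => if (i : ℕ) < k then (1 - ε) • v else w' - ε • w)
    (fun i => hscale _ (by split_ifs; exacts [hv, subset_closure hw]) ε hε0)
    (fun i => by
      split_ifs
      exacts [hscale v hv _ (sub_pos.2 hε1), subset_closure hεC])
  rw [F.map_smul_univ (fun _ => ε)] at hle
  have hsum : ((fun i : Fin n => ε • if (i : ℕ) < k then v else w) +
      fun i : Fin n => if (i : ℕ) < k then (1 - ε) • v else w' - ε • w) =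
      fun i : Fin n => if (i : ℕ) < k then v else w' := by
    funext i
    simp only [Pi.add_apply]
    split_ifs <;> module
  rw [hsum] at hle
  exact (smul_pos (Finset.prod_pos fun _ _ => hε0) h).trans_le hle

/-- Let `F` be a `C`-Lorentzian symmetric `n`-multilinear form on a
finite-dimensional real vector space `V`, where `C ⊆ V` is a nonempty open convex cone. Then
for every `v` in the closure of `C`, the number `nd_w(v) = max{k : F(v[k], w[n-k]) > 0}` is
independent of the choice of `w ∈ C`. -/
theorem numDim_well_defined
    {V : Type*} [NormedAddCommGroup V] [NormedSpace ℝ V] [FiniteDimensional ℝ V]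
    {n : ℕ} (hn : 0 < n)
    (C : Set V) (hCne : C.Nonempty) (hCopen : IsOpen C) (hCconv : Convex ℝ C)
    (hCcone : ∀ x ∈ C, ∀ t : ℝ, 0 < t → t • x ∈ C)
    (F : MultilinearMap ℝ (fun _ : Fin n => V) ℝ)
    (hFsymm : ∀ (σ : Equiv.Perm (Fin n)) (v : Fin n → V), F (v ∘ σ) = F v)
    (hFpos : ∀ v : Fin n → V, (∀ i, v i ∈ C) → 0 < F v)
    (hFlor : ∀ v : Fin n → V, (∀ i : Fin n, 2 ≤ (i : ℕ) → v i ∈ C) →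
      (∃ ξ : V, 0 < biEval F v ξ ξ) ∧
      ∀ W : Submodule ℝ V, (∀ ξ ∈ W, ξ ≠ 0 → 0 < biEval F v ξ ξ) →
        Module.finrank ℝ W ≤ 1)
    (v : V) (hv : v ∈ closure C)
    (w₁ w₂ : V) (hw₁ : w₁ ∈ C) (hw₂ : w₂ ∈ C) :
    numDim F w₁ v = numDim F w₂ v := by
  unfold numDim
  congr 1
  ext k
  exact and_congr_right fun _ =>
    ⟨F.pos_of_pos_of_mem_cone hCopen hCcone hFpos hv hw₁ hw₂ k,
      F.pos_of_pos_of_mem_cone hCopen hCcone hFpos hv hw₂ hw₁ k⟩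
end

section
/- Let F be a C-Lorentzian symmetric n-multilinear form on a finite-dimensional real vector space V, where C ⊆ V is a nonempty open convex cone with closure C̄, and let nd denote the associated numerical dimension. Then nd is submodular on C̄: for any x, y, z ∈ C̄ one has nd(x+y+z) + nd(z) ≤ nd(x+z) + nd(y+z). -/
section SetFunctions

variable {ι : Type*} [DecidableEq ι]

/-- If a positive set function satisfies a local submodularity inequality up to a factor `c`,
its increments along one element decrease up to powers of `c`. -/
theorem mul_insert_union_le_of_local {q : Finset ι → ℝ} {c : ℝ} (hq : ∀ S, 0 < q S)
    (hc : 0 ≤ c)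
    (hloc : ∀ (S : Finset ι) (i j : ι), i ∉ S → j ∉ S → i ≠ j →
      q (insert i (insert j S)) * q S ≤ c * (q (insert i S) * q (insert j S)))
    (A : Finset ι) (j : ι) (hj : j ∉ A) (B : Finset ι) (hAB : Disjoint A B) (hjB : j ∉ B) :
    q (insert j (A ∪ B)) * q A ≤ c ^ B.card * (q (insert j A) * q (A ∪ B)) := by
  induction B using Finset.induction_on with
  | empty => simp
  | insert i B hi ih =>
    rw [Finset.disjoint_insert_right] at hAB
    rw [Finset.mem_insert, not_or] at hjB
    have ih := ih hAB.2 hjB.2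
    have h := hloc (A ∪ B) j i (by simp [hj, hjB.2]) (by simp [hAB.1, hi]) hjB.1
    rw [Finset.union_insert, Finset.card_insert_of_notMem hi]
    refine le_of_mul_le_mul_right ?_ (hq (A ∪ B))
    calc q (insert j (insert i (A ∪ B))) * q A * q (A ∪ B)
        = (q (insert j (insert i (A ∪ B))) * q (A ∪ B)) * q A := by ring
      _ ≤ (c * (q (insert j (A ∪ B)) * q (insert i (A ∪ B)))) * q A :=
        mul_le_mul_of_nonneg_right h (hq A).le
      _ = (c * q (insert i (A ∪ B))) * (q (insert j (A ∪ B)) * q A) := by ring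
      _ ≤ (c * q (insert i (A ∪ B))) * (c ^ B.card * (q (insert j A) * q (A ∪ B))) :=
        mul_le_mul_of_nonneg_left ih (mul_nonneg hc (hq _).le)
      _ = _ := by ring

/-- A positive set function which is locally submodular up to a factor `c` is submodular on
disjoint sets up to a power of `c`. -/
theorem mul_union_le_of_local {q : Finset ι → ℝ} {c : ℝ} (hq : ∀ S, 0 < q S) (hc : 0 ≤ c)
    (hloc : ∀ (S : Finset ι) (i j : ι), i ∉ S → j ∉ S → i ≠ j →
      q (insert i (insert j S)) * q S ≤ c * (q (insert i S) * q (insert j S)))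
    (A B : Finset ι) (hAB : Disjoint A B) :
    q (A ∪ B) * q ∅ ≤ c ^ (A.card * B.card) * (q A * q B) := by
  induction A using Finset.induction_on with
  | empty => simp [mul_comm]
  | insert j A hj ih =>
    rw [Finset.disjoint_insert_left] at hAB
    have ih := ih hAB.2
    have h := mul_insert_union_le_of_local hq hc hloc A j hj B hAB.2 hAB.1
    rw [Finset.insert_union, Finset.card_insert_of_notMem hj]
    refine le_of_mul_le_mul_right ?_ (mul_pos (hq A) (hq (A ∪ B)))
    calc q (insert j (A ∪ B)) * q ∅ * (q A * q (A ∪ B))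
        = (q (insert j (A ∪ B)) * q A) * (q (A ∪ B) * q ∅) := by ring
      _ ≤ (c ^ B.card * (q (insert j A) * q (A ∪ B))) * (c ^ (A.card * B.card) * (q A * q B)) :=
        mul_le_mul h ih (mul_pos (hq _) (hq _)).le
          (mul_nonneg (pow_nonneg hc _) (mul_pos (hq _) (hq _)).le)
      _ = _ := by ring

end SetFunctions

section BilinearForms

variable {V : Type*} [AddCommGroup V] [Module ℝ V]

/-- The reversed Cauchy-Schwarz inequality for forms of Lorentzian signature. -/
theorem mul_le_sq_of_finrank_le_one {b : V →ₗ[ℝ] V →ₗ[ℝ] ℝ} (hsymm : ∀ x y, b x y = b y x)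
    (hb : ∀ W : Submodule ℝ V, (∀ ξ ∈ W, ξ ≠ 0 → 0 < b ξ ξ) → Module.finrank ℝ W ≤ 1)
    {u z : V} (hz : 0 < b z z) : b u u * b z z ≤ b u z ^ 2 := by
  by_contra! h
  have key : ∀ α β : ℝ, (α ≠ 0 ∨ β ≠ 0) → 0 < b (α • u + β • z) (α • u + β • z) := by
    intro α β hαβ
    have e : b (α • u + β • z) (α • u + β • z) * b z z =
        (β * b z z + α * b u z) ^ 2 + α ^ 2 * (b u u * b z z - b u z ^ 2) := by
      simp only [map_add, map_smul, LinearMap.add_apply, LinearMap.smul_apply, smul_eq_mul,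
        hsymm z u]
      ring
    refine pos_of_mul_pos_left (b := b z z) ?_ hz.le
    rw [e]
    by_cases hα : α = 0
    · have hβ : β ≠ 0 := hαβ.resolve_left (not_not_intro hα)
      have : 0 < (β * b z z) ^ 2 := by positivity
      simpa [hα] using this
    · have : 0 < α ^ 2 * (b u u * b z z - b u z ^ 2) :=
        mul_pos (by positivity) (sub_pos.2 h)
      positivity
  have hli : LinearIndependent ℝ ![u, z] := by
    rw [LinearIndependent.pair_iff]
    intro α β h0
    by_contra hne
    have := key α β (by tauto)
    simp [h0] at this
  have hW := hb (Submodule.span ℝ (Set.range ![u, z])) (by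
    intro ξ hξ hξ0
    rw [Matrix.range_cons, Matrix.range_cons, Matrix.range_empty, Set.union_empty,
      Set.singleton_union, Submodule.mem_span_pair] at hξ
    obtain ⟨α, β, rfl⟩ := hξ
    refine key α β ?_
    by_contra! h0
    simp [h0.1, h0.2] at hξ0)
  rw [finrank_span_eq_card hli] at hW
  simp at hW

/-- In Lorentzian signature, `b(x,y) b(z,z) ≤ 2 b(x,z) b(y,z)` for vectors in the positive
cone. -/
theorem mul_le_two_mul_of_finrank_le_one {b : V →ₗ[ℝ] V →ₗ[ℝ] ℝ}
    (hsymm : ∀ x y, b x y = b y x)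
    (hb : ∀ W : Submodule ℝ V, (∀ ξ ∈ W, ξ ≠ 0 → 0 < b ξ ξ) → Module.finrank ℝ W ≤ 1)
    {x y z : V} (hx : 0 ≤ b x x) (hy : 0 ≤ b y y) (hz : 0 < b z z)
    (hxz : 0 < b x z) (hyz : 0 < b y z) :
    b x y * b z z ≤ 2 * (b x z * b y z) := by
  have h := mul_le_sq_of_finrank_le_one hsymm hb (u := b y z • x + b x z • y) hz
  simp only [map_add, map_smul, LinearMap.add_apply, LinearMap.smul_apply, smul_eq_mul,
    hsymm y x] at h
  have h1 : 0 ≤ b y z ^ 2 * b x x * b z z := by positivity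
  have h2 : 0 ≤ b x z ^ 2 * b y y * b z z := by positivity
  refine le_of_mul_le_mul_left ?_ (mul_pos (mul_pos two_pos hxz) hyz)
  linarith

end BilinearForms

section Cones

variable {V : Type*} [NormedAddCommGroup V] [NormedSpace ℝ V] {C : Set V}

theorem add_mem_of_mem_closure_of_mem (hCopen : IsOpen C) (hCconv : Convex ℝ C)
    (hCcone : ∀ x ∈ C, ∀ t : ℝ, 0 < t → t • x ∈ C) {x y : V} (hx : x ∈ closure C)
    (hy : y ∈ C) : x + y ∈ C := by
  have h := hCconv.combo_closure_interior_mem_interior hx (by rwa [hCopen.interior_eq])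
    (a := 1 / 2) (b := 1 / 2) (by norm_num) (by norm_num) (by norm_num)
  rw [hCopen.interior_eq] at h
  have h' := hCcone _ h 2 two_pos
  simpa [smul_smul] using h'

theorem add_mem_closure_of_cone (hCopen : IsOpen C) (hCconv : Convex ℝ C)
    (hCcone : ∀ x ∈ C, ∀ t : ℝ, 0 < t → t • x ∈ C) {x y : V} (hx : x ∈ closure C)
    (hy : y ∈ closure C) : x + y ∈ closure C :=
  map_mem_closure (continuous_const_add x) hy fun _ hv =>
    add_mem_of_mem_closure_of_mem hCopen hCconv hCcone hx hv

end Cones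

section Multilinear

variable {V : Type*} [AddCommGroup V] [Module ℝ V] {n : ℕ}

theorem MultilinearMap.map_add_smul_expand {ι : Type*} [Fintype ι] [DecidableEq ι]
    (F : MultilinearMap ℝ (fun _ : ι => V) ℝ) (v : ι → V) (w : ι → V) (t : ℝ) :
    F (fun i => v i + t • w i) =
      ∑ s : Finset ι, t ^ (Fintype.card ι - s.card) * F (s.piecewise v w) := by
  have h := F.map_add_univ v (fun i => t • w i)
  refine (show F (fun i => v i + t • w i) = F (v + fun i => t • w i) from rfl).trans
    (h.trans (Finset.sum_congr rfl fun s _ => ?_))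
  have e : s.piecewise v (fun i => t • w i) =
      fun i => (if i ∈ s then (1 : ℝ) else t) • s.piecewise v w i := by
    funext i
    by_cases hi : i ∈ s <;> simp [hi]
  rw [e, F.map_smul_univ, smul_eq_mul]
  congr 1
  rw [Finset.prod_ite]
  simp [Finset.filter_not, Finset.card_sdiff]

/-- By symmetry, only the number of arguments equal to `v` matters, not their positions. -/
theorem MultilinearMap.map_piecewise_eq_of_symm
    (F : MultilinearMap ℝ (fun _ : Fin n => V) ℝ)
    (hFsymm : ∀ (σ : Equiv.Perm (Fin n)) (v : Fin n → V), F (v ∘ σ) = F v)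
    (s : Finset (Fin n)) (v w : V) :
    F (s.piecewise (fun _ => v) (fun _ => w)) =
      F (fun i => if (i : ℕ) < s.card then v else w) := by
  have hcard : Fintype.card {i // i ∈ s} = Fintype.card {i : Fin n // (i : ℕ) < s.card} := by
    rw [Fintype.card_coe, Fintype.card_subtype, Fin.card_filter_val_lt]
    have := s.card_le_univ
    rw [Fintype.card_fin] at this
    omega
  let e := Fintype.equivOfCardEq hcard
  rw [← hFsymm e.extendSubtype (fun i => if (i : ℕ) < s.card then v else w)]
  congr 1
  funext i
  by_cases hi : i ∈ s
  · have := e.extendSubtype_mem i hi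
    simp [hi, this]
  · have := e.extendSubtype_not_mem i hi
    simp [hi, this]

/-- The bilinear form obtained from a multilinear map by letting two arguments vary. -/
def MultilinearMap.bilinAt {ι : Type*} [DecidableEq ι]
    (F : MultilinearMap ℝ (fun _ : ι => V) ℝ) (f : ι → V) (i j : ι) (hij : i ≠ j) :
    V →ₗ[ℝ] V →ₗ[ℝ] ℝ :=
  LinearMap.mk₂ ℝ (fun x y => F (Function.update (Function.update f i x) j y))
    (fun x x' y => by simp only [Function.update_comm hij, F.map_update_add])
    (fun c x y => by simp only [Function.update_comm hij, F.map_update_smul])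
    (fun x y y' => F.map_update_add _ _ _ _)
    (fun c x y => F.map_update_smul _ _ _ _)

theorem MultilinearMap.bilinAt_apply {ι : Type*} [DecidableEq ι]
    (F : MultilinearMap ℝ (fun _ : ι => V) ℝ) (f : ι → V) (i j : ι) (hij : i ≠ j) (x y : V) :
    F.bilinAt f i j hij x y = F (Function.update (Function.update f i x) j y) := rfl

theorem exists_perm_map_zero_one (i j : Fin n) (hij : i ≠ j) :
    ∃ σ : Equiv.Perm (Fin n), ∀ k, (σ k = i ↔ (k : ℕ) = 0) ∧ (σ k = j ↔ (k : ℕ) = 1) := by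
  have hn : 1 < n := by
    have := i.isLt; have := j.isLt
    have : (i : ℕ) ≠ j := fun h => hij (Fin.ext h)
    omega
  let a : Fin n := ⟨0, by omega⟩
  let b : Fin n := ⟨1, hn⟩
  have hab : a ≠ b := by simp [a, b, Fin.ext_iff]
  let τ := Equiv.swap a i
  have hτ : τ a = i := Equiv.swap_apply_left _ _
  have hj : a ≠ τ.symm j := fun h => hij (by rw [← hτ, h, Equiv.apply_symm_apply])
  let σ := (Equiv.swap b (τ.symm j)).trans τ
  have hσa : σ a = i := by
    simp only [σ, Equiv.trans_apply]
    rw [Equiv.swap_apply_of_ne_of_ne hab hj, hτ]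
  have hσb : σ b = j := by simp [σ]
  refine ⟨σ, fun k => ⟨?_, ?_⟩⟩
  · rw [← hσa, σ.injective.eq_iff, Fin.ext_iff]
  · rw [← hσb, σ.injective.eq_iff, Fin.ext_iff]

theorem MultilinearMap.exists_biEval_eq_bilinAt
    (F : MultilinearMap ℝ (fun _ : Fin n => V) ℝ)
    (hFsymm : ∀ (σ : Equiv.Perm (Fin n)) (v : Fin n → V), F (v ∘ σ) = F v)
    (f : Fin n → V) (i j : Fin n) (hij : i ≠ j) :
    ∃ σ : Equiv.Perm (Fin n), ∀ x y, biEval F (f ∘ σ) x y = F.bilinAt f i j hij x y := by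
  obtain ⟨σ, hσ⟩ := exists_perm_map_zero_one i j hij
  refine ⟨σ, fun x y => ?_⟩
  rw [F.bilinAt_apply, ← hFsymm σ, biEval]
  congr 1
  funext k
  obtain ⟨h0, h1⟩ := hσ k
  by_cases hk0 : (k : ℕ) = 0
  · have h := h0.2 hk0
    simp [hk0, h, hij]
  · by_cases hk1 : (k : ℕ) = 1
    · have h := h1.2 hk1
      simp [hk1, h]
    · have h0' : σ k ≠ i := fun h => hk0 (h0.1 h)
      have h1' : σ k ≠ j := fun h => hk1 (h1.1 h)
      simp [hk0, hk1, h0', h1']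

theorem MultilinearMap.bilinAt_symm
    (F : MultilinearMap ℝ (fun _ : Fin n => V) ℝ)
    (hFsymm : ∀ (σ : Equiv.Perm (Fin n)) (v : Fin n → V), F (v ∘ σ) = F v)
    (f : Fin n → V) (i j : Fin n) (hij : i ≠ j) (x y : V) :
    F.bilinAt f i j hij x y = F.bilinAt f i j hij y x := by
  rw [F.bilinAt_apply, F.bilinAt_apply, ← hFsymm (Equiv.swap i j)]
  congr 1
  funext k
  by_cases hi : k = i
  · subst hi; simp [hij]
  · by_cases hj : k = j
    · subst hj; simp [hij]
    · simp [Equiv.swap_apply_of_ne_of_ne hi hj, hi, hj]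

end Multilinear

section NumericalDimension

variable {V : Type*} [AddCommGroup V] [Module ℝ V] {n : ℕ}

theorem numDim_bddAbove (F : MultilinearMap ℝ (fun _ : Fin n => V) ℝ) (w v : V) :
    BddAbove {k : ℕ | k ≤ n ∧ 0 < F (fun i => if (i : ℕ) < k then v else w)} :=
  ⟨n, fun _ hk => hk.1⟩

theorem numDim_spec (F : MultilinearMap ℝ (fun _ : Fin n => V) ℝ) {w : V} (v : V)
    (hw : 0 < F (fun _ => w)) :
    numDim F w v ≤ n ∧ 0 < F (fun i => if (i : ℕ) < numDim F w v then v else w) :=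
  Nat.sSup_mem (s := {k : ℕ | k ≤ n ∧ 0 < F (fun i => if (i : ℕ) < k then v else w)})
    ⟨0, by simpa using hw⟩ (numDim_bddAbove F w v)

theorem le_numDim (F : MultilinearMap ℝ (fun _ : Fin n => V) ℝ) {w v : V} {k : ℕ} (hk : k ≤ n)
    (h : 0 < F (fun i => if (i : ℕ) < k then v else w)) : k ≤ numDim F w v :=
  le_csSup (numDim_bddAbove F w v) ⟨hk, h⟩

/-- `F((v + t w)[n])` is at most of order `t ^ (n - nd(v))` as `t → 0`. -/
theorem exists_map_add_smul_le_pow (F : MultilinearMap ℝ (fun _ : Fin n => V) ℝ)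
    (hFsymm : ∀ (σ : Equiv.Perm (Fin n)) (v : Fin n → V), F (v ∘ σ) = F v) (w v : V) :
    ∃ K : ℝ, 0 ≤ K ∧ ∀ t : ℝ, 0 < t → t ≤ 1 →
      F (fun _ => v + t • w) ≤ K * t ^ (n - numDim F w v) := by
  refine ⟨∑ s : Finset (Fin n), |F (s.piecewise (fun _ => v) (fun _ => w))|,
    Finset.sum_nonneg fun _ _ => abs_nonneg _, fun t ht ht1 => ?_⟩
  rw [F.map_add_smul_expand (fun _ => v) (fun _ => w), Finset.sum_mul]
  refine Finset.sum_le_sum fun s _ => ?_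
  rw [Fintype.card_fin, mul_comm]
  by_cases hs : 0 < F (s.piecewise (fun _ => v) (fun _ => w))
  · have hcard : s.card ≤ numDim F w v := by
      refine le_numDim F (by simpa using s.card_le_univ) ?_
      rwa [← F.map_piecewise_eq_of_symm hFsymm]
    exact mul_le_mul (le_abs_self _) (pow_le_pow_of_le_one ht.le ht1 (by omega))
      (by positivity) (abs_nonneg _)
  · exact (mul_nonpos_of_nonpos_of_nonneg (not_lt.1 hs) (by positivity)).trans (by positivity)

/-- Scaling the last `n - k` arguments by `t` multiplies the value by `t ^ (n - k)`. -/
theorem MultilinearMap.map_ite_smul (F : MultilinearMap ℝ (fun _ : Fin n => V) ℝ)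
    (g : Fin n → V) (t : ℝ) {k : ℕ} (hk : k ≤ n) :
    F (fun i => (if (i : ℕ) < k then (1 : ℝ) else t) • g i) = t ^ (n - k) * F g := by
  rw [F.map_smul_univ, smul_eq_mul, Finset.prod_ite, Finset.filter_not, Finset.prod_const_one,
    Finset.prod_const, Finset.card_sdiff_of_subset (Finset.filter_subset _ _),
    Fin.card_filter_val_lt]
  simp [hk]

end NumericalDimension

section Lorentzian

variable {V : Type*} [NormedAddCommGroup V] [NormedSpace ℝ V] {n : ℕ} {C : Set V}

theorem MultilinearMap.nonneg_of_mem_closure_s6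
    (hCne : C.Nonempty) (hCopen : IsOpen C) (hCconv : Convex ℝ C)
    (hCcone : ∀ x ∈ C, ∀ t : ℝ, 0 < t → t • x ∈ C)
    (F : MultilinearMap ℝ (fun _ : Fin n => V) ℝ)
    (hFpos : ∀ v : Fin n → V, (∀ i, v i ∈ C) → 0 < F v)
    (v : Fin n → V) (hv : ∀ i, v i ∈ closure C) : 0 ≤ F v := by
  obtain ⟨w, hw⟩ := hCne
  have hcont : Continuous fun t : ℝ => F (fun i => v i + t • w) := by
    simp only [F.map_add_smul_expand v (fun _ => w)]
    fun_prop
  have h : Filter.Tendsto (fun t : ℝ => F (fun i => v i + t • w)) (nhdsWithin 0 (Set.Ioi 0))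
      (nhds (F v)) := by
    simpa using (hcont.tendsto 0).mono_left nhdsWithin_le_nhds
  exact ge_of_tendsto h (Filter.eventually_of_mem self_mem_nhdsWithin fun t ht =>
    (hFpos _ fun i => add_mem_of_mem_closure_of_mem hCopen hCconv hCcone (hv i)
      (hCcone w hw t ht)).le)

theorem MultilinearMap.mono_of_mem_closure
    (hCne : C.Nonempty) (hCopen : IsOpen C) (hCconv : Convex ℝ C)
    (hCcone : ∀ x ∈ C, ∀ t : ℝ, 0 < t → t • x ∈ C)
    (F : MultilinearMap ℝ (fun _ : Fin n => V) ℝ)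
    (hFpos : ∀ v : Fin n → V, (∀ i, v i ∈ C) → 0 < F v)
    (u v : Fin n → V) (hu : ∀ i, u i ∈ closure C) (huv : ∀ i, v i - u i ∈ closure C) :
    F u ≤ F v := by
  have e : v = u + (v - u) := by simp
  rw [e, F.map_add_univ]
  have h := Finset.single_le_sum (f := fun s : Finset (Fin n) => F (s.piecewise u (v - u)))
    (s := Finset.univ) (fun s _ => F.nonneg_of_mem_closure_s6 hCne hCopen hCconv hCcone hFpos _
      fun i => by by_cases hi : i ∈ s <;> simp [hi, hu, huv]) (Finset.mem_univ Finset.univ)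
  simpa using h

/-- The local exchange inequality for Lorentzian forms: the values with arguments `f i` on `S`
and `z` elsewhere are submodular in `S` up to a factor `2`. -/
theorem MultilinearMap.piecewise_local_submodular
    (F : MultilinearMap ℝ (fun _ : Fin n => V) ℝ)
    (hFsymm : ∀ (σ : Equiv.Perm (Fin n)) (v : Fin n → V), F (v ∘ σ) = F v)
    (hFpos : ∀ v : Fin n → V, (∀ i, v i ∈ C) → 0 < F v)
    (hFlor : ∀ v : Fin n → V, (∀ i : Fin n, 2 ≤ (i : ℕ) → v i ∈ C) →
      ∀ W : Submodule ℝ V, (∀ ξ ∈ W, ξ ≠ 0 → 0 < biEval F v ξ ξ) → Module.finrank ℝ W ≤ 1)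
    (f : Fin n → V) (hf : ∀ i, f i ∈ C) (z : V) (hz : z ∈ C)
    (S : Finset (Fin n)) (i j : Fin n) (hi : i ∉ S) (hj : j ∉ S) (hij : i ≠ j) :
    F ((insert i (insert j S)).piecewise f (fun _ => z)) * F (S.piecewise f (fun _ => z)) ≤
      2 * (F ((insert i S).piecewise f (fun _ => z)) *
        F ((insert j S).piecewise f (fun _ => z))) := by
  set g : Fin n → V := S.piecewise f (fun _ => z) with hg
  have hgC : ∀ k, g k ∈ C := fun k => by by_cases hk : k ∈ S <;> simp [hg, hk, hf, hz]
  obtain ⟨σ, hσ⟩ := F.exists_biEval_eq_bilinAt hFsymm g i j hij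
  have hpos : ∀ x ∈ C, ∀ y ∈ C, 0 < F.bilinAt g i j hij x y := fun x hx y hy => by
    rw [F.bilinAt_apply]
    refine hFpos _ fun k => ?_
    by_cases hkj : k = j
    · subst hkj; simpa using hy
    · by_cases hki : k = i
      · subst hki; simpa [hkj] using hx
      · simpa [hki, hkj] using hgC k
  have hmain := mul_le_two_mul_of_finrank_le_one (b := F.bilinAt g i j hij)
    (F.bilinAt_symm hFsymm g i j hij)
    (fun W hW => hFlor (g ∘ σ) (fun k _ => hgC _) W (by simpa only [hσ] using hW))
    (hpos _ (hf i) _ (hf i)).le (hpos _ (hf j) _ (hf j)).le (hpos _ hz _ hz)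
    (hpos _ (hf i) _ hz) (hpos _ (hf j) _ hz)
  rw [F.bilinAt_symm hFsymm g i j hij (f j) z] at hmain
  have hzz : Function.update (Function.update g i z) j z = g := by
    have h1 : g i = z := by simp [hg, hi]
    have h2 : g j = z := by simp [hg, hj]
    have h3 : Function.update g i z = g := Function.update_eq_iff.2 ⟨h1.symm, fun _ _ => rfl⟩
    rw [h3]
    exact Function.update_eq_iff.2 ⟨h2.symm, fun _ _ => rfl⟩
  have hiz : Function.update (Function.update g i (f i)) j z =
      (insert i S).piecewise f (fun _ => z) := by
    rw [Finset.piecewise_insert, ← hg]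
    refine Function.update_eq_iff.2 ⟨?_, fun _ _ => rfl⟩
    simp [hg, hj, hij.symm]
  have hzj : Function.update (Function.update g i z) j (f j) =
      (insert j S).piecewise f (fun _ => z) := by
    rw [Finset.piecewise_insert, ← hg]
    congr 1
    refine Function.update_eq_iff.2 ⟨?_, fun _ _ => rfl⟩
    simp [hg, hi]
  have hxy : Function.update (Function.update g i (f i)) j (f j) =
      (insert i (insert j S)).piecewise f (fun _ => z) := by
    rw [Finset.piecewise_insert, Finset.piecewise_insert, ← hg, Function.update_comm hij]
  simpa only [F.bilinAt_apply, hzz, hiz, hzj, hxy] using hmain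

end Lorentzian

/-- Comparing orders of vanishing at `0`. -/
theorem le_of_mul_pow_le_mul_pow {A K : ℝ} {a b : ℕ} (hA : 0 < A)
    (h : ∀ t : ℝ, 0 < t → t ≤ 1 → A * t ^ a ≤ K * t ^ b) : b ≤ a := by
  by_contra! hlt
  obtain ⟨d, rfl⟩ := Nat.exists_eq_add_of_lt hlt
  have hK : A ≤ K := by simpa using h 1 one_pos le_rfl
  have hKpos : 0 < K := hA.trans_le hK
  have ht : 0 < A / (2 * K) := by positivity
  have ht1 : A / (2 * K) ≤ 1 := by rw [div_le_one (by positivity)]; linarith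
  have h1 := h _ ht ht1
  have h2 : K * (A / (2 * K)) ^ (a + d + 1) ≤ K * (A / (2 * K)) ^ (a + 1) :=
    mul_le_mul_of_nonneg_left (pow_le_pow_of_le_one ht.le ht1 (by omega)) hKpos.le
  have h3 : K * (A / (2 * K)) ^ (a + 1) = A / 2 * (A / (2 * K)) ^ a := by
    rw [pow_succ]
    field_simp
  have h4 : 0 < A / 2 * (A / (2 * K)) ^ a := by positivity
  linarith

/-- Let `F` be a `C`-Lorentzian symmetric `n`-multilinear form on a
finite-dimensional real vector space `V`, where `C ⊆ V` is a nonempty open convex cone, and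
let `nd` be the associated numerical dimension. Then `nd` is submodular on the closure of `C`:
for any `x, y, z` in the closure of `C`, `nd(x+y+z) + nd(z) ≤ nd(x+z) + nd(y+z)`. -/
theorem numDim_submodular
    {V : Type*} [NormedAddCommGroup V] [NormedSpace ℝ V] [FiniteDimensional ℝ V]
    {n : ℕ} (hn : 0 < n)
    (C : Set V) (hCne : C.Nonempty) (hCopen : IsOpen C) (hCconv : Convex ℝ C)
    (hCcone : ∀ x ∈ C, ∀ t : ℝ, 0 < t → t • x ∈ C)
    (F : MultilinearMap ℝ (fun _ : Fin n => V) ℝ)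
    (hFsymm : ∀ (σ : Equiv.Perm (Fin n)) (v : Fin n → V), F (v ∘ σ) = F v)
    (hFpos : ∀ v : Fin n → V, (∀ i, v i ∈ C) → 0 < F v)
    (hFlor : ∀ v : Fin n → V, (∀ i : Fin n, 2 ≤ (i : ℕ) → v i ∈ C) →
      (∃ ξ : V, 0 < biEval F v ξ ξ) ∧
      ∀ W : Submodule ℝ V, (∀ ξ ∈ W, ξ ≠ 0 → 0 < biEval F v ξ ξ) →
        Module.finrank ℝ W ≤ 1)
    (w : V) (hw : w ∈ C)
    (x y z : V) (hx : x ∈ closure C) (hy : y ∈ closure C) (hz : z ∈ closure C) :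
    numDim F w (x + y + z) + numDim F w z ≤ numDim F w (x + z) + numDim F w (y + z) := by
  classical
  have hFlor' := fun v hv => (hFlor v hv).2
  have hadd {a b : V} (ha : a ∈ closure C) (hb : b ∈ closure C) : a + b ∈ closure C :=
    add_mem_closure_of_cone hCopen hCconv hCcone ha hb
  have htw {t : ℝ} (ht : 0 < t) : t • w ∈ C := hCcone w hw t ht
  have hww : 0 < F (fun _ => w) := hFpos _ fun _ => hw
  have hmono := F.mono_of_mem_closure hCne hCopen hCconv hCcone hFpos
  obtain ⟨hk, hkpos⟩ := numDim_spec F (x + y + z) hww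
  obtain ⟨hm, hmpos⟩ := numDim_spec F z hww
  have hp := (numDim_spec F (x + z) hww).1
  have hq := (numDim_spec F (y + z) hww).1
  obtain ⟨K₁, hK₁, hup₁⟩ := exists_map_add_smul_le_pow F hFsymm w (x + z)
  obtain ⟨K₂, hK₂, hup₂⟩ := exists_map_add_smul_le_pow F hFsymm w (y + z)
  set k := numDim F w (x + y + z)
  set m := numDim F w z
  set p := numDim F w (x + z)
  set q := numDim F w (y + z)
  have hmem : ∀ r : Fin 3, ![x, y, z] r ∈ closure C := by
    intro r; fin_cases r <;> simp [hx, hy, hz]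
  obtain ⟨r, hr⟩ : ∃ r : Fin n → Fin 3,
      0 < F (fun i => if (i : ℕ) < k then ![x, y, z] (r i) else (1 / 3 : ℝ) • w) := by
    have e : (fun i : Fin n => if (i : ℕ) < k then x + y + z else w) =
        fun i : Fin n => ∑ j : Fin 3, if (i : ℕ) < k then ![x, y, z] j else (1 / 3 : ℝ) • w := by
      funext i
      by_cases hi : (i : ℕ) < k
      · simp [hi, Fin.sum_univ_three]
      · simp only [hi, if_false, Fin.sum_univ_three, ← add_smul]
        norm_num
    rw [e, F.map_sum] at hkpos
    obtain ⟨r, -, hr⟩ := Finset.exists_lt_of_sum_lt (f := fun _ => (0 : ℝ)) (by simpa only [Finset.sum_const_zero] using hkpos)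
    exact ⟨r, hr⟩
  set A := Finset.univ.filter fun i => r i = 0 with hA
  set B := Finset.univ.filter fun i => r i = 1 with hB
  have hAB : Disjoint A B := by
    rw [Finset.disjoint_left]
    intro i hiA hiB
    simp only [hA, hB, Finset.mem_filter, Finset.mem_univ, true_and] at hiA hiB
    rw [hiA] at hiB
    exact absurd hiB (by decide)
  suffices h : (n - p) + (n - q) ≤ (n - k) + (n - m) by omega
  refine le_of_mul_pow_le_mul_pow (K := 2 ^ (A.card * B.card) * (K₁ * K₂))
    (mul_pos hr hmpos) fun t ht ht1 => ?_
  set f : Fin n → V := fun i => ![x, y, z] (r i) + t • w with hf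
  have hfC : ∀ i, f i ∈ C := fun i =>
    add_mem_of_mem_closure_of_mem hCopen hCconv hCcone (hmem _) (htw ht)
  have hzC : z + t • w ∈ C := add_mem_of_mem_closure_of_mem hCopen hCconv hCcone hz (htw ht)
  have hmain := mul_union_le_of_local (q := fun S => F (S.piecewise f fun _ => z + t • w))
    (fun S => hFpos _ fun i => by by_cases hi : i ∈ S <;> simp [hi, hfC, hzC]) zero_le_two
    (F.piecewise_local_submodular hFsymm hFpos hFlor' f hfC _ hzC) A B hAB
  simp only [Finset.piecewise_empty] at hmain
  have hunion : (A ∪ B).piecewise f (fun _ => z + t • w) = f := by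
    funext i
    by_cases hi : i ∈ A ∪ B
    · simp [hi]
    · rw [Finset.piecewise_eq_of_notMem _ _ _ hi]
      simp only [hA, hB, Finset.mem_union, Finset.mem_filter, Finset.mem_univ, true_and] at hi
      have h2 : r i = 2 := by omega
      simp [hf, h2]
  rw [hunion] at hmain
  have hlow₁ : t ^ (n - k) *
      F (fun i => if (i : ℕ) < k then ![x, y, z] (r i) else (1 / 3 : ℝ) • w) ≤ F f := by
    rw [← F.map_ite_smul _ t hk]
    refine hmono _ _ (fun i => ?_) fun i => ?_
    · by_cases hi : (i : ℕ) < k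
      · simpa [hi] using hmem (r i)
      · simp only [hi, if_false]
        exact subset_closure (hCcone _ (hCcone w hw _ (by norm_num)) t ht)
    · by_cases hi : (i : ℕ) < k
      · simpa [hi, hf] using subset_closure (htw ht)
      · have e : ![x, y, z] (r i) + t • w - t • (1 / 3 : ℝ) • w =
            ![x, y, z] (r i) + (t * (2 / 3)) • w := by module
        simp only [hi, if_false, hf, e]
        exact hadd (hmem _) (subset_closure (htw (by positivity)))
  have hlow₂ : t ^ (n - m) * F (fun i => if (i : ℕ) < m then z else w) ≤
      F (fun _ => z + t • w) := by
    rw [← F.map_ite_smul _ t hm]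
    refine hmono _ _ (fun i => ?_) fun i => ?_
    · by_cases hi : (i : ℕ) < m
      · simpa [hi] using hz
      · simpa [hi] using subset_closure (htw ht)
    · by_cases hi : (i : ℕ) < m
      · simpa [hi] using subset_closure (htw ht)
      · simpa [hi] using hz
  have hA' : F (A.piecewise f fun _ => z + t • w) ≤ K₁ * t ^ (n - p) := by
    refine (hmono _ (fun _ => x + z + t • w) (fun i => ?_) fun i => ?_).trans (hup₁ t ht ht1)
    · by_cases hi : i ∈ A <;> simp only [hi, Finset.piecewise_eq_of_mem,
        Finset.piecewise_eq_of_notMem, not_false_eq_true]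
      exacts [subset_closure (hfC i), subset_closure hzC]
    · by_cases hi : i ∈ A
      · have h0 : r i = 0 := by simpa [hA] using hi
        simpa [hi, hf, h0] using hz
      · simpa [hi] using hx
  have hB' : F (B.piecewise f fun _ => z + t • w) ≤ K₂ * t ^ (n - q) := by
    refine (hmono _ (fun _ => y + z + t • w) (fun i => ?_) fun i => ?_).trans (hup₂ t ht ht1)
    · by_cases hi : i ∈ B <;> simp only [hi, Finset.piecewise_eq_of_mem,
        Finset.piecewise_eq_of_notMem, not_false_eq_true]
      exacts [subset_closure (hfC i), subset_closure hzC]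
    · by_cases hi : i ∈ B
      · have h0 : r i = 1 := by simpa [hB] using hi
        simpa [hi, hf, h0] using hz
      · simpa [hi] using hy
  have hBpos : 0 ≤ F (B.piecewise f fun _ => z + t • w) :=
    (hFpos _ fun i => by by_cases hi : i ∈ B <;> simp [hi, hfC, hzC]).le
  have hl := mul_le_mul hlow₁ hlow₂ (by positivity) (hFpos f hfC).le
  have hu := mul_le_mul hA' hB' hBpos (by positivity)
  have hu' := mul_le_mul_of_nonneg_left hu (pow_nonneg zero_le_two (A.card * B.card) : (0:ℝ) ≤ _)
  rw [pow_add, pow_add]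
  linarith
end

section
/- Let F be a C-Lorentzian symmetric n-multilinear form on a finite-dimensional real vector space V, where C ⊆ V is a nonempty open convex cone with closure C̄. Fix ω ∈ C and let m ∈ {1,...,n}. Then for any α₁, ..., α_m ∈ C̄ the following are equivalent: (1) F(α₁,...,α_m, ω[n−m]) > 0; (2) for every nonempty subset I ⊆ {1,...,m}, nd(α_I) ≥ |I|, where α_I = Σ_{i∈I} α_i. -/
namespace CLorentzian

open Function

section Cone

variable {V : Type*} [NormedAddCommGroup V] [NormedSpace ℝ V] {C : Set V}

lemma add_mem_closure (hconv : Convex ℝ C) (hcone : ∀ x ∈ C, ∀ t : ℝ, 0 < t → t • x ∈ C)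
    {x y : V} (hx : x ∈ closure C) (hy : y ∈ closure C) : x + y ∈ closure C := by
  refine map_mem_closure₂ continuous_add hx hy fun a ha b hb => ?_
  have h := hcone _ (hconv ha hb (by norm_num : (0 : ℝ) ≤ 1 / 2)
    (by norm_num : (0 : ℝ) ≤ 1 / 2) (by norm_num)) 2 (by norm_num)
  simpa [smul_smul] using h

lemma smul_mem_closure (hcone : ∀ x ∈ C, ∀ t : ℝ, 0 < t → t • x ∈ C)
    {x : V} (hx : x ∈ closure C) {t : ℝ} (ht : 0 < t) : t • x ∈ closure C :=
  map_mem_closure (continuous_const_smul t) hx fun a ha => hcone a ha t ht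

lemma zero_mem_closure (hne : C.Nonempty) (hcone : ∀ x ∈ C, ∀ t : ℝ, 0 < t → t • x ∈ C) :
    (0 : V) ∈ closure C := by
  obtain ⟨x, hx⟩ := hne
  have h0 : (0 : ℝ) ∈ closure (Set.Ioi 0) := by simp
  have hc : Continuous fun t : ℝ => t • x := by fun_prop
  simpa using map_mem_closure hc h0 fun t ht => hcone x hx t ht

lemma sum_mem_closure (hne : C.Nonempty) (hconv : Convex ℝ C)
    (hcone : ∀ x ∈ C, ∀ t : ℝ, 0 < t → t • x ∈ C) {ι : Type*} (s : Finset ι) {f : ι → V}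
    (hf : ∀ i ∈ s, f i ∈ closure C) : ∑ i ∈ s, f i ∈ closure C :=
  Finset.sum_induction f (· ∈ closure C) (fun _ _ => add_mem_closure hconv hcone)
    (zero_mem_closure hne hcone) hf

lemma sum_sub_mem_closure (hne : C.Nonempty) (hconv : Convex ℝ C)
    (hcone : ∀ x ∈ C, ∀ t : ℝ, 0 < t → t • x ∈ C) {ι : Type*} [DecidableEq ι] {s : Finset ι}
    {f : ι → V} (hf : ∀ i ∈ s, f i ∈ closure C) {j : ι} (hj : j ∈ s) :
    ∑ i ∈ s, f i - f j ∈ closure C := by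
  rw [← Finset.add_sum_erase s f hj, add_sub_cancel_left]
  exact sum_mem_closure hne hconv hcone _ fun i hi => hf i (Finset.mem_of_mem_erase hi)

lemma exists_smul_sub_mem (hopen : IsOpen C) {ω : V} (hω : ω ∈ C) (x : V) :
    ∃ t : ℝ, 0 < t ∧ ω - t • x ∈ C := by
  have hc : Continuous fun t : ℝ => ω - t • x := by fun_prop
  have h : ∀ᶠ t : ℝ in nhds 0, ω - t • x ∈ C :=
    hc.continuousAt.eventually (hopen.mem_nhds (by simpa using hω))
  have hpos : ∀ᶠ t : ℝ in nhdsWithin 0 (Set.Ioi 0), 0 < t := self_mem_nhdsWithin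
  exact (hpos.and (h.filter_mono nhdsWithin_le_nhds)).exists

end Cone

section Topology

variable {V : Type*} [TopologicalSpace V] {n : ℕ} {C : Set V}

/-- Membership of every argument in `closure C` suffices for closed conditions that hold on `C`. -/
lemma closed_of_forall_mem {p : (Fin n → V) → Prop} (hp : IsClosed {v | p v})
    (h : ∀ v : Fin n → V, (∀ i, v i ∈ C) → p v) {v : Fin n → V} (hv : ∀ i, v i ∈ closure C) :
    p v := by
  have hsub : Set.pi Set.univ (fun _ : Fin n => C) ⊆ {v | p v} :=
    fun w hw => h w (by simpa using hw)
  refine closure_minimal hsub hp ?_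
  rw [closure_pi_set]
  simpa using hv

lemma update_mem_closure {v : Fin n → V} (hv : ∀ k, v k ∈ closure C) {x : V}
    (hx : x ∈ closure C) (i : Fin n) : ∀ k, update v i x k ∈ closure C := by
  intro k
  by_cases hk : k = i
  · subst hk
    simpa using hx
  · simpa [hk] using hv k

lemma piecewise_mem_closure {f g : Fin n → V} {S : Finset (Fin n)}
    (hf : ∀ i ∈ S, f i ∈ closure C) (hg : ∀ i, g i ∈ closure C) :
    ∀ i, S.piecewise f g i ∈ closure C := by
  intro i
  by_cases hi : i ∈ S
  · simpa [hi] using hf i hi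
  · simpa [hi] using hg i

end Topology

section Form

variable {V : Type*} [NormedAddCommGroup V] [NormedSpace ℝ V] {n : ℕ} {C : Set V}
  {F : MultilinearMap ℝ (fun _ : Fin n => V) ℝ}

lemma continuous_of_finiteDimensional [FiniteDimensional ℝ V]
    (F : MultilinearMap ℝ (fun _ : Fin n => V) ℝ) : Continuous F := by
  set b := Module.finBasis ℝ V
  have h (v : Fin n → V) : F v = ∑ r : Fin n → Fin (Module.finrank ℝ V),
      (∏ i, b.coord (r i) (v i)) * F fun i => b (r i) := by
    conv_lhs => rw [show v = fun i => ∑ k, b.coord k (v i) • b k from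
      funext fun i => (b.sum_repr (v i)).symm]
    rw [F.map_sum]
    simp only [F.map_smul_univ, smul_eq_mul]
  have hb (k) : Continuous (b.coord k) := LinearMap.continuous_of_finiteDimensional _
  rw [show ⇑F = _ from funext h]
  fun_prop

lemma nonneg_of_mem_closure [FiniteDimensional ℝ V]
    (hpos : ∀ v : Fin n → V, (∀ i, v i ∈ C) → 0 < F v)
    {v : Fin n → V} (hv : ∀ i, v i ∈ closure C) : 0 ≤ F v :=
  closed_of_forall_mem (p := fun v => 0 ≤ F v)
    (isClosed_le continuous_const (continuous_of_finiteDimensional F))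
    (fun v hv => (hpos v hv).le) hv

lemma mono_of_sub_mem_closure [FiniteDimensional ℝ V]
    (hpos : ∀ v : Fin n → V, (∀ i, v i ∈ C) → 0 < F v)
    {v w : Fin n → V} (hv : ∀ i, v i ∈ closure C) (hvw : ∀ i, w i - v i ∈ closure C) :
    F v ≤ F w := by
  have h := F.map_add_univ v (w - v)
  rw [add_sub_cancel] at h
  rw [h]
  refine le_trans (le_of_eq ?_) (Finset.single_le_sum (f := fun s : Finset (Fin n) =>
    F (s.piecewise v (w - v))) (fun s _ => nonneg_of_mem_closure hpos fun i => ?_)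
    (Finset.mem_univ Finset.univ))
  · simp
  · by_cases hi : i ∈ s
    · simpa [hi] using hv i
    · simpa [hi] using hvw i

lemma exists_perm_pair (hn : 1 < n) {i j : Fin n} (hij : i ≠ j) :
    ∃ σ : Equiv.Perm (Fin n), σ ⟨0, by omega⟩ = i ∧ σ ⟨1, hn⟩ = j := by
  set z : Fin n := ⟨0, by omega⟩
  set o : Fin n := ⟨1, hn⟩
  have hzo : o ≠ z := by simp [z, o]
  set τ := Equiv.swap z i
  have hτz : τ z = i := Equiv.swap_apply_left _ _
  have hτo : i ≠ τ o := fun h => hzo (τ.injective (by rw [hτz, ← h]))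
  exact ⟨τ.trans (Equiv.swap (τ o) j), by simp [hτz, Equiv.swap_apply_of_ne_of_ne hτo hij],
    by simp⟩

lemma biEval_comp_perm (hn : 1 < n)
    (hsymm : ∀ (σ : Equiv.Perm (Fin n)) (v : Fin n → V), F (v ∘ σ) = F v)
    {i j : Fin n} {σ : Equiv.Perm (Fin n)}
    (hi : σ ⟨0, by omega⟩ = i) (hj : σ ⟨1, hn⟩ = j) (v : Fin n → V) (x y : V) :
    biEval F (v ∘ σ) x y = F (update (update v i x) j y) := by
  rw [← hsymm σ, biEval]
  congr 1
  funext k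
  subst hi hj
  by_cases h1 : (k : ℕ) = 1
  · obtain rfl : k = ⟨1, hn⟩ := Fin.ext h1
    simp
  by_cases h0 : (k : ℕ) = 0
  · obtain rfl : k = ⟨0, zero_lt_one.trans hn⟩ := Fin.ext h0
    simp
  · have hk1 : k ≠ ⟨1, hn⟩ := fun h => h1 (by rw [h])
    have hk0 : k ≠ ⟨0, by omega⟩ := fun h => h0 (by rw [h])
    simp [h0, h1, hk0, hk1]

lemma map_update_update_add_smul {i j : Fin n} (hij : i ≠ j) (v : Fin n → V) (a b : V)
    (s t : ℝ) :
    F (update (update v i (s • a + t • b)) j (s • a + t • b)) =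
      s ^ 2 * F (update (update v i a) j a) + s * t * F (update (update v i a) j b) +
        s * t * F (update (update v i b) j a) + t ^ 2 * F (update (update v i b) j b) := by
  simp only [MultilinearMap.map_update_add, MultilinearMap.map_update_smul]
  simp only [update_comm hij, MultilinearMap.map_update_add, MultilinearMap.map_update_smul,
    smul_eq_mul]
  ring

lemma map_update_update_comm
    (hsymm : ∀ (σ : Equiv.Perm (Fin n)) (v : Fin n → V), F (v ∘ σ) = F v)
    {i j : Fin n} (hij : i ≠ j) (v : Fin n → V) (a b : V) :
    F (update (update v i a) j b) = F (update (update v i b) j a) := by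
  rw [← hsymm (Equiv.swap i j)]
  congr 1
  funext k
  by_cases hki : k = i
  · subst hki
    simp [hij]
  by_cases hkj : k = j
  · subst hkj
    simp [hij]
  · simp [Equiv.swap_apply_of_ne_of_ne hki hkj, hki, hkj]

lemma pos_quadratic {A B D : ℝ} (hA : 0 < A) (h : B ^ 2 < A * D) {s t : ℝ}
    (hst : ¬(s = 0 ∧ t = 0)) : 0 < s ^ 2 * A + s * t * B + s * t * B + t ^ 2 * D := by
  have key : A * (s ^ 2 * A + s * t * B + s * t * B + t ^ 2 * D) =
      (s * A + t * B) ^ 2 + t ^ 2 * (A * D - B ^ 2) := by ring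
  refine pos_of_mul_pos_right (a := A) ?_ hA.le
  rw [key]
  by_cases ht : t = 0
  · subst ht
    have hs : s ≠ 0 := fun hs => hst ⟨hs, rfl⟩
    simp only [zero_mul, add_zero]
    positivity
  · have : 0 < A * D - B ^ 2 := by linarith
    positivity

/-- The hypothesis that all the forms obtained by fixing `n - 2` arguments in `C` have exactly
one positive eigenvalue. -/
def HasOnePositiveEigenvalue (C : Set V) (F : MultilinearMap ℝ (fun _ : Fin n => V) ℝ) : Prop :=
  ∀ v : Fin n → V, (∀ i : Fin n, 2 ≤ (i : ℕ) → v i ∈ C) →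
    (∃ ξ : V, 0 < biEval F v ξ ξ) ∧
    ∀ W : Submodule ℝ V, (∀ ξ ∈ W, ξ ≠ 0 → 0 < biEval F v ξ ξ) → Module.finrank ℝ W ≤ 1

lemma reverse_cauchy_schwarz_of_mem
    (hsymm : ∀ (σ : Equiv.Perm (Fin n)) (v : Fin n → V), F (v ∘ σ) = F v)
    (hpos : ∀ v : Fin n → V, (∀ i, v i ∈ C) → 0 < F v) (hlor : HasOnePositiveEigenvalue C F)
    {i j : Fin n} (hij : i ≠ j) {v : Fin n → V} (hv : ∀ k, v k ∈ C) :
    F (update v j (v i)) * F (update v i (v j)) ≤ F v ^ 2 := by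
  have hn : 1 < n := by
    have h1 := i.isLt
    have h2 := j.isLt
    have h3 : (i : ℕ) ≠ j := fun h => hij (Fin.ext h)
    omega
  obtain ⟨σ, hi, hj⟩ := exists_perm_pair hn hij
  set a := v i with ha
  set b := v j with hb
  have hA : update v j a = update (update v i a) j a := by simp [a]
  have hD : update v i b = update (update v i b) j b := by
    rw [update_comm hij]
    simp [b]
  have hB : v = update (update v i a) j b := by simp [a, b]
  by_contra! h
  rw [hA, hD] at h
  rw [congrArg F hB] at h
  have hAA : 0 < F (update (update v i a) j a) := by
    rw [← hA]
    refine hpos _ fun k => ?_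
    by_cases hk : k = j
    · subst hk
      simpa using hv i
    · simpa [hk] using hv k
  have hQ (s t : ℝ) (hst : ¬(s = 0 ∧ t = 0)) :
      0 < biEval F (v ∘ σ) (s • a + t • b) (s • a + t • b) := by
    rw [biEval_comp_perm hn hsymm hi hj, map_update_update_add_smul hij,
      map_update_update_comm hsymm hij v b a]
    exact pos_quadratic hAA h hst
  have hle := (hlor (v ∘ σ) fun k _ => hv _).2 (Submodule.span ℝ {a, b}) fun ξ hξ hξ0 => by
    obtain ⟨s, t, rfl⟩ := Submodule.mem_span_pair.1 hξ
    refine hQ s t ?_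
    rintro ⟨rfl, rfl⟩
    simp at hξ0
  have hind : LinearIndependent ℝ ![a, b] := by
    rw [LinearIndependent.pair_iff]
    intro s t hst
    by_contra hne
    have h0 := hQ s t hne
    rw [hst, biEval_comp_perm hn hsymm hi hj,
      F.map_coord_zero (m := update (update v i 0) j 0) j (by simp)] at h0
    exact lt_irrefl _ h0
  have hrank := finrank_span_eq_card hind
  rw [Matrix.range_cons_cons_empty, Fintype.card_fin] at hrank
  omega

lemma reverse_cauchy_schwarz [FiniteDimensional ℝ V]
    (hsymm : ∀ (σ : Equiv.Perm (Fin n)) (v : Fin n → V), F (v ∘ σ) = F v)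
    (hpos : ∀ v : Fin n → V, (∀ i, v i ∈ C) → 0 < F v) (hlor : HasOnePositiveEigenvalue C F)
    {i j : Fin n} (hij : i ≠ j) {v : Fin n → V} (hv : ∀ k, v k ∈ closure C) :
    F (update v j (v i)) * F (update v i (v j)) ≤ F v ^ 2 := by
  have hF : Continuous F := continuous_of_finiteDimensional F
  refine closed_of_forall_mem (p := fun v => F (update v j (v i)) * F (update v i (v j)) ≤ F v ^ 2)
    (isClosed_le ?_ (hF.pow 2))
    (fun v hv => reverse_cauchy_schwarz_of_mem hsymm hpos hlor hij hv) hv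
  exact (hF.comp (continuous_id.update j (continuous_apply i))).mul
    (hF.comp (continuous_id.update i (continuous_apply j)))

/-- If two arguments are orthogonal with respect to the remaining ones, and the second is not
orthogonal to `ω`, then the first is isotropic. -/
lemma map_update_eq_zero [FiniteDimensional ℝ V] (hconv : Convex ℝ C)
    (hcone : ∀ x ∈ C, ∀ t : ℝ, 0 < t → t • x ∈ C)
    (hsymm : ∀ (σ : Equiv.Perm (Fin n)) (v : Fin n → V), F (v ∘ σ) = F v)
    (hpos : ∀ v : Fin n → V, (∀ i, v i ∈ C) → 0 < F v) (hlor : HasOnePositiveEigenvalue C F)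
    {ω : V} (hω : ω ∈ C) {i j : Fin n} (hij : i ≠ j) {v : Fin n → V}
    (hv : ∀ k, v k ∈ closure C) (h0 : F v = 0) (hiω : 0 < F (update v i ω)) :
    F (update v j (v i)) = 0 := by
  have hωc := subset_closure hω
  have hnn : 0 ≤ F (update v j (v i)) :=
    nonneg_of_mem_closure hpos (update_mem_closure hv (hv i) j)
  have hbb : 0 ≤ F (update v i (v j)) :=
    nonneg_of_mem_closure hpos (update_mem_closure hv (hv j) i)
  have hww : 0 ≤ F (update (update v i ω) j ω) :=
    nonneg_of_mem_closure hpos (update_mem_closure (update_mem_closure hv hωc i) hωc j)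
  have hvi : update (update v i (v j)) j (v j) = update v i (v j) := by
    rw [update_comm hij]
    simp
  have hvω : update (update v i ω) j (v j) = update v i ω := by
    rw [update_comm hij]
    simp
  set P := F (update v i ω)
  set R := F (update v j ω)
  have key (s : ℝ) (hs : 0 < s) : F (update v j (v i)) * (2 * P) ≤ s * R ^ 2 := by
    have hw : ∀ k, update v j (v j + s • ω) k ∈ closure C :=
      update_mem_closure hv
        (add_mem_closure hconv hcone (hv j) (smul_mem_closure hcone hωc hs)) j
    have h := reverse_cauchy_schwarz hsymm hpos hlor hij hw
    have e1 : F (update v j (v j + s • ω)) = s * R := by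
      rw [F.map_update_add, F.map_update_smul, update_eq_self, h0, zero_add, smul_eq_mul]
    have e2 : F (update (update v j (v j + s • ω)) i (v j + s • ω)) =
        F (update v i (v j)) + 2 * s * P + s ^ 2 * F (update (update v i ω) j ω) := by
      rw [update_comm hij.symm]
      have := map_update_update_add_smul (F := F) hij v (v j) ω 1 s
      rw [one_smul] at this
      rw [this, map_update_update_comm hsymm hij v (v j) ω, hvi, hvω]
      ring
    rw [e1] at h
    simp only [update_self, update_of_ne hij, update_idem] at h
    rw [e2] at h
    have h1 : F (update v j (v i)) * (2 * s * P) ≤ (s * R) ^ 2 := by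
      refine le_trans (mul_le_mul_of_nonneg_left ?_ hnn) h
      nlinarith [mul_nonneg (sq_nonneg s) hww]
    refine le_of_mul_le_mul_left (a := s) ?_ hs
    nlinarith
  have hlim : F (update v j (v i)) * (2 * P) ≤ 0 := by
    refine le_of_forall_pos_le_add fun ε hε => ?_
    rw [zero_add]
    refine (key (ε / (R ^ 2 + 1)) (by positivity)).trans ?_
    rw [div_mul_eq_mul_div, div_le_iff₀ (by positivity)]
    nlinarith
  nlinarith

lemma pos_update_of_pos [FiniteDimensional ℝ V] (hne : C.Nonempty) (hopen : IsOpen C)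
    (hcone : ∀ x ∈ C, ∀ t : ℝ, 0 < t → t • x ∈ C)
    (hpos : ∀ v : Fin n → V, (∀ i, v i ∈ C) → 0 < F v)
    {ω : V} (hω : ω ∈ C) {v : Fin n → V} (hv : ∀ k, v k ∈ closure C) (h : 0 < F v) (i : Fin n) :
    0 < F (update v i ω) := by
  obtain ⟨t, ht, hmem⟩ := exists_smul_sub_mem hopen hω (v i)
  have hle : F (update v i (t • v i)) ≤ F (update v i ω) := by
    refine mono_of_sub_mem_closure hpos
      (update_mem_closure hv (smul_mem_closure hcone (hv i) ht) i) fun k => ?_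
    by_cases hk : k = i
    · subst hk
      simpa using subset_closure hmem
    · simpa [hk] using zero_mem_closure hne hcone
  rw [F.map_update_smul, update_eq_self, smul_eq_mul] at hle
  exact (mul_pos ht h).trans_le hle

lemma pos_piecewise_of_subset [FiniteDimensional ℝ V] (hne : C.Nonempty) (hopen : IsOpen C)
    (hcone : ∀ x ∈ C, ∀ t : ℝ, 0 < t → t • x ∈ C)
    (hpos : ∀ v : Fin n → V, (∀ i, v i ∈ C) → 0 < F v)
    {ω : V} (hω : ω ∈ C) {f : Fin n → V} {S I : Finset (Fin n)}
    (hf : ∀ i ∈ S, f i ∈ closure C) (hIS : I ⊆ S)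
    (h : 0 < F (S.piecewise f fun _ => ω)) : 0 < F (I.piecewise f fun _ => ω) := by
  have key (T : Finset (Fin n)) : 0 < F ((S \ T).piecewise f fun _ => ω) := by
    induction T using Finset.induction_on with
    | empty => rwa [Finset.sdiff_empty]
    | insert i T _ ih =>
      have := pos_update_of_pos hne hopen hcone hpos hω
        (piecewise_mem_closure (fun k hk => hf k (Finset.mem_sdiff.1 hk).1)
          fun _ => subset_closure hω) ih i
      convert this using 2
      funext k
      by_cases hk : k = i
      · subst hk
        simp
      · simp [Finset.piecewise, hk]
  rw [← Finset.sdiff_sdiff_eq_self hIS]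
  exact key (S \ I)

lemma map_piecewise_const_of_card_eq
    (hsymm : ∀ (σ : Equiv.Perm (Fin n)) (v : Fin n → V), F (v ∘ σ) = F v)
    {S T : Finset (Fin n)} (hST : S.card = T.card) (x ω : V) :
    F (S.piecewise (fun _ => x) fun _ => ω) = F (T.piecewise (fun _ => x) fun _ => ω) := by
  set σ : Equiv.Perm (Fin n) := (Finset.equivOfCardEq hST).extendSubtype
  rw [← hsymm σ (T.piecewise _ _)]
  congr 1
  funext k
  by_cases hk : k ∈ S
  · have : σ k ∈ T := Equiv.extendSubtype_mem _ k hk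
    simp [hk, this]
  · have : σ k ∉ T := Equiv.extendSubtype_not_mem _ k hk
    simp [hk, this]

lemma card_le_numDim_iff [FiniteDimensional ℝ V] (hne : C.Nonempty) (hopen : IsOpen C)
    (hcone : ∀ x ∈ C, ∀ t : ℝ, 0 < t → t • x ∈ C)
    (hsymm : ∀ (σ : Equiv.Perm (Fin n)) (v : Fin n → V), F (v ∘ σ) = F v)
    (hpos : ∀ v : Fin n → V, (∀ i, v i ∈ C) → 0 < F v)
    {ω : V} (hω : ω ∈ C) {x : V} (hx : x ∈ closure C) (S : Finset (Fin n)) :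
    S.card ≤ numDim F ω x ↔ 0 < F (S.piecewise (fun _ => x) fun _ => ω) := by
  have hset (k : ℕ) (hk : k ≤ n) : ∃ T : Finset (Fin n), T.card = k ∧
      (fun i : Fin n => if (i : ℕ) < k then x else ω) = T.piecewise (fun _ => x) fun _ => ω := by
    refine ⟨Finset.univ.filter fun i : Fin n => (i : ℕ) < k, ?_, ?_⟩
    · simp [Fin.card_filter_val_lt, hk]
    · funext i
      simp [Finset.piecewise]
  have hbdd : BddAbove {k : ℕ | k ≤ n ∧ 0 < F (fun i => if (i : ℕ) < k then x else ω)} :=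
    ⟨n, fun k hk => hk.1⟩
  constructor
  · intro h
    have hmem : numDim F ω x ∈
        {k : ℕ | k ≤ n ∧ 0 < F (fun i => if (i : ℕ) < k then x else ω)} :=
      Nat.sSup_mem ⟨0, Nat.zero_le _, by simpa using hpos _ fun _ => hω⟩ hbdd
    obtain ⟨hle, hlt⟩ := hmem
    obtain ⟨T, hT, he⟩ := hset _ hle
    rw [he] at hlt
    obtain ⟨U, hUT, hU⟩ := Finset.exists_subset_card_eq (hT ▸ h)
    rw [← map_piecewise_const_of_card_eq hsymm hU]
    exact pos_piecewise_of_subset hne hopen hcone hpos hω (fun _ _ => hx) hUT hlt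
  · intro h
    have hle : S.card ≤ n := by simpa using S.card_le_univ
    obtain ⟨T, hT, he⟩ := hset _ hle
    refine le_csSup hbdd ⟨hle, ?_⟩
    rw [he, map_piecewise_const_of_card_eq hsymm hT]
    exact h

lemma pos_piecewise_sum_of_pos [FiniteDimensional ℝ V] (hne : C.Nonempty) (hconv : Convex ℝ C)
    (hcone : ∀ x ∈ C, ∀ t : ℝ, 0 < t → t • x ∈ C)
    (hpos : ∀ v : Fin n → V, (∀ i, v i ∈ C) → 0 < F v)
    {ω : V} (hω : ω ∈ C) {f : Fin n → V} {S : Finset (Fin n)} (hf : ∀ i ∈ S, f i ∈ closure C)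
    (h : 0 < F (S.piecewise f fun _ => ω)) :
    0 < F (S.piecewise (fun _ => ∑ i ∈ S, f i) fun _ => ω) := by
  refine h.trans_le (mono_of_sub_mem_closure hpos
    (piecewise_mem_closure hf fun _ => subset_closure hω) fun i => ?_)
  by_cases hi : i ∈ S
  · simpa [hi] using sum_sub_mem_closure hne hconv hcone hf hi
  · simpa [hi] using zero_mem_closure hne hcone

/-- If `F` vanishes at `(f i)_{i ∈ S}` padded by `ω`, but not after replacing any one of the `f i`
by `ω`, then it vanishes after replacing every `f i` by their sum. -/
lemma map_piecewise_sum_eq_zero [FiniteDimensional ℝ V] (hne : C.Nonempty) (hconv : Convex ℝ C)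
    (hcone : ∀ x ∈ C, ∀ t : ℝ, 0 < t → t • x ∈ C)
    (hsymm : ∀ (σ : Equiv.Perm (Fin n)) (v : Fin n → V), F (v ∘ σ) = F v)
    (hpos : ∀ v : Fin n → V, (∀ i, v i ∈ C) → 0 < F v) (hlor : HasOnePositiveEigenvalue C F)
    {ω : V} (hω : ω ∈ C) {f : Fin n → V} {S : Finset (Fin n)} (hS : S.Nonempty)
    (hf : ∀ i ∈ S, f i ∈ closure C) (h0 : F (S.piecewise f fun _ => ω) = 0)
    (hminor : ∀ i ∈ S, 0 < F (update (S.piecewise f fun _ => ω) i ω)) :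
    F (S.piecewise (fun _ => ∑ i ∈ S, f i) fun _ => ω) = 0 := by
  obtain ⟨j, hj⟩ := hS
  set v := S.piecewise f fun _ => ω
  set β := ∑ i ∈ S, f i with hβ
  have hωc := subset_closure hω
  have hv : ∀ i, v i ∈ closure C := piecewise_mem_closure hf fun _ => hωc
  have hβc : β ∈ closure C := sum_mem_closure hne hconv hcone S hf
  have hvS {i : Fin n} (hi : i ∈ S) : v i = f i := by simp [v, hi]
  have hstart : F (update v j β) = 0 := by
    rw [hβ, F.map_update_sum]
    refine Finset.sum_eq_zero fun i hi => ?_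
    rw [← hvS hi]
    by_cases hij : i = j
    · subst hij
      rwa [update_eq_self]
    · exact map_update_eq_zero hconv hcone hsymm hpos hlor hω hij hv h0 (hminor i hi)
  have key (T : Finset (Fin n)) (hT : T ⊆ S.erase j) :
      F (update (T.piecewise (fun _ => β) v) j β) = 0 := by
    induction T using Finset.induction_on with
    | empty => simpa using hstart
    | insert i T _ ih =>
      obtain ⟨hi, hTS⟩ := Finset.insert_subset_iff.1 hT
      have hij : i ≠ j := Finset.ne_of_mem_erase hi
      set w := T.piecewise (fun _ => β) v
      have hw : ∀ k, w k ∈ closure C := piecewise_mem_closure (fun _ _ => hβc) hv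
      have hle : F (update v j ω) ≤ F (update w j ω) := by
        refine mono_of_sub_mem_closure hpos (update_mem_closure hv hωc j) fun k => ?_
        by_cases hkj : k = j
        · subst hkj
          simpa using zero_mem_closure hne hcone
        by_cases hk : k ∈ T
        · have hkS := Finset.mem_of_mem_erase (hTS hk)
          simpa [hkj, w, hk, hvS hkS] using sum_sub_mem_closure hne hconv hcone hf hkS
        · simpa [hkj, w, hk] using zero_mem_closure hne hcone
      have := map_update_eq_zero hconv hcone hsymm hpos hlor hω hij.symm
        (update_mem_closure hw hβc j) (ih hTS)
        (by simpa using (hminor j hj).trans_le hle)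
      rw [update_self, update_comm hij.symm] at this
      rwa [Finset.piecewise_insert]
  convert key (S.erase j) subset_rfl using 2
  funext k
  by_cases hk : k = j
  · subst hk
    simp [hj]
  · by_cases hkS : k ∈ S <;> simp [v, hk, hkS]

lemma pos_piecewise_of_pos_sum [FiniteDimensional ℝ V] (hne : C.Nonempty) (hconv : Convex ℝ C)
    (hcone : ∀ x ∈ C, ∀ t : ℝ, 0 < t → t • x ∈ C)
    (hsymm : ∀ (σ : Equiv.Perm (Fin n)) (v : Fin n → V), F (v ∘ σ) = F v)
    (hpos : ∀ v : Fin n → V, (∀ i, v i ∈ C) → 0 < F v) (hlor : HasOnePositiveEigenvalue C F)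
    {ω : V} (hω : ω ∈ C) {f : Fin n → V} (S : Finset (Fin n)) (hf : ∀ i ∈ S, f i ∈ closure C)
    (h : ∀ I ⊆ S, I.Nonempty → 0 < F (I.piecewise (fun _ => ∑ i ∈ I, f i) fun _ => ω)) :
    0 < F (S.piecewise f fun _ => ω) := by
  induction S using Finset.strongInduction with
  | H S ih =>
    rcases S.eq_empty_or_nonempty with rfl | hS
    · simpa using hpos _ fun _ => hω
    by_contra hnot
    have hv := piecewise_mem_closure hf fun _ : Fin n => subset_closure hω
    have h0 := le_antisymm (not_lt.1 hnot) (nonneg_of_mem_closure hpos hv)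
    refine (h S subset_rfl hS).ne' (map_piecewise_sum_eq_zero hne hconv hcone hsymm hpos hlor hω hS
      hf h0 fun i hi => ?_)
    have := ih (S.erase i) (Finset.erase_ssubset hi)
      (fun k hk => hf k (Finset.mem_of_mem_erase hk))
      fun I hI => h I (hI.trans (Finset.erase_subset i S))
    convert this using 2
    funext k
    by_cases hk : k = i
    · subst hk
      simp
    · simp [Finset.piecewise, hk]

end Form

end CLorentzian

/-- (Non-vanishing criterion.) Let `F` be a `C`-Lorentzian symmetric
`n`-multilinear form on a finite-dimensional real vector space `V`, where `C ⊆ V` is a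
nonempty open convex cone. Fix `ω ∈ C` and `m ∈ {1,...,n}`. Then for any `α₁, ..., α_m` in
the closure of `C`, `F(α₁,...,α_m, ω[n-m]) > 0` iff `nd(α_I) ≥ |I|` for every nonempty
`I ⊆ {1,...,m}`, where `α_I = Σ_{i∈I} α_i`. -/
theorem lorentzian_nonvanishing_criterion
    {V : Type*} [NormedAddCommGroup V] [NormedSpace ℝ V] [FiniteDimensional ℝ V]
    {n : ℕ} (hn : 0 < n)
    (C : Set V) (hCne : C.Nonempty) (hCopen : IsOpen C) (hCconv : Convex ℝ C)
    (hCcone : ∀ x ∈ C, ∀ t : ℝ, 0 < t → t • x ∈ C)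
    (F : MultilinearMap ℝ (fun _ : Fin n => V) ℝ)
    (hFsymm : ∀ (σ : Equiv.Perm (Fin n)) (v : Fin n → V), F (v ∘ σ) = F v)
    (hFpos : ∀ v : Fin n → V, (∀ i, v i ∈ C) → 0 < F v)
    (hFlor : ∀ v : Fin n → V, (∀ i : Fin n, 2 ≤ (i : ℕ) → v i ∈ C) →
      (∃ ξ : V, 0 < biEval F v ξ ξ) ∧
      ∀ W : Submodule ℝ V, (∀ ξ ∈ W, ξ ≠ 0 → 0 < biEval F v ξ ξ) →
        Module.finrank ℝ W ≤ 1)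
    (m : ℕ) (hm1 : 1 ≤ m) (hm2 : m ≤ n)
    (ω : V) (hω : ω ∈ C)
    (α : Fin m → V) (hα : ∀ i, α i ∈ closure C) :
    0 < F (fun i => if h : (i : ℕ) < m then α ⟨(i : ℕ), h⟩ else ω) ↔
      ∀ I : Finset (Fin m), I.Nonempty → I.card ≤ numDim F ω (∑ i ∈ I, α i) := by
  classical
  set f : Fin n → V := fun i => if h : (i : ℕ) < m then α ⟨(i : ℕ), h⟩ else ω
  set e : Fin m ↪ Fin n := Fin.castLEEmb hm2
  have hfe (i : Fin m) : f (e i) = α i := by simp [f, e]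
  have hsum (I : Finset (Fin m)) : ∑ i ∈ I.map e, f i = ∑ i ∈ I, α i := by
    simp [Finset.sum_map, hfe]
  have hf : ∀ i ∈ Finset.univ.map e, f i ∈ closure C := by
    intro i hi
    obtain ⟨k, -, rfl⟩ := Finset.mem_map.1 hi
    exact hfe k ▸ hα k
  have hfS : f = (Finset.univ.map e).piecewise f fun _ => ω := by
    funext i
    by_cases hi : i ∈ Finset.univ.map e
    · simp [hi]
    · have him : ¬ (i : ℕ) < m := fun h =>
        hi (Finset.mem_map.2 ⟨⟨i, h⟩, Finset.mem_univ _, Fin.ext rfl⟩)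
      rw [Finset.piecewise_eq_of_notMem _ _ _ hi]
      simp [f, him]
  have hnd (I : Finset (Fin m)) : I.card ≤ numDim F ω (∑ i ∈ I, α i) ↔
      0 < F ((I.map e).piecewise (fun _ => ∑ i ∈ I.map e, f i) fun _ => ω) := by
    rw [← CLorentzian.card_le_numDim_iff hCne hCopen hCcone hFsymm hFpos hω
      (CLorentzian.sum_mem_closure hCne hCconv hCcone _ fun i hi =>
        hf i (Finset.map_subset_map.2 I.subset_univ hi)), Finset.card_map, hsum]
  simp only [hnd]
  rw [congrArg F hfS]
  constructor
  · intro h I _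
    have hI : I.map e ⊆ Finset.univ.map e := Finset.map_subset_map.2 I.subset_univ
    exact CLorentzian.pos_piecewise_sum_of_pos hCne hCconv hCcone hFpos hω (fun i hi => hf i (hI hi))
      (CLorentzian.pos_piecewise_of_subset hCne hCopen hCcone hFpos hω hf hI h)
  · intro h
    refine CLorentzian.pos_piecewise_of_pos_sum hCne hCconv hCcone hFsymm hFpos hFlor hω _ hf
      fun J hJ hJne => ?_
    obtain ⟨I, -, rfl⟩ := Finset.subset_map_iff.1 hJ
    exact h I (Finset.map_nonempty.1 hJne)
end
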